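/- arXiv:2404.14226 — 2 statements merged into one kernel-verified Lean document; each statement's English description precedes it below -/
import Mathlib

section
/- Fix an integer k ≥ 2, integers 0 ≤ m ≤ ℓ, reals p, q ∈ [1,∞), and constants C_F, c₁, c₂ > 0. There exists C > 0, depending only on k, ℓ, m, p, q, C_F, c₁, c₂, such that for every h ∈ (0,1], every map F : ℝ² → ℝ² with polynomial components of total degree ≤ k satisfying the isoparametric bounds of order k (with constants C_F, c₁, c₂ and parameter h), every v̂ : ℝ² → ℝ² with polynomial components of total degree ≤ k, and every i ∈ {1,2,3}, the Piola transform v of v̂ under F satisfies ‖v‖_{W^{ℓ,p}(F(K̂ᵢ))} ≤ C h^{m − ℓ + 2(1/p − 1/q)} ‖v‖_{W^{m,q}(F(K̂ᵢ))}. -/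
open Set MeasureTheory Function

noncomputable section

/-- The open reference triangle with vertices (0,0), (1,0), (0,1). -/
def Tref : Set (ℝ × ℝ) := {x | 0 < x.1 ∧ 0 < x.2 ∧ x.1 + x.2 < 1}

/-- The three vertices of the reference triangle. -/
def vtx : Fin 3 → ℝ × ℝ := ![(0, 0), (1, 0), (0, 1)]

/-- The (open) Clough–Tocher subtriangles, obtained by connecting the barycenter
to the vertices. -/
def ctK (i : Fin 3) : Set (ℝ × ℝ) :=
  interior (convexHull ℝ {vtx i, vtx (i + 1), ((1 : ℝ) / 3, (1 : ℝ) / 3)})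

/-- A map `ℝ² → ℝ²` whose two components are polynomials of total degree ≤ k. -/
def IsPolyMap (k : ℕ) (F : ℝ × ℝ → ℝ × ℝ) : Prop :=
  ∃ P Q : MvPolynomial (Fin 2) ℝ, P.totalDegree ≤ k ∧ Q.totalDegree ≤ k ∧
    ∀ x : ℝ × ℝ,
      F x = (MvPolynomial.eval ![x.1, x.2] P, MvPolynomial.eval ![x.1, x.2] Q)

/-- The Jacobian determinant of `F`. -/
def jacDet (F : ℝ × ℝ → ℝ × ℝ) (x : ℝ × ℝ) : ℝ :=
  LinearMap.det ((fderiv ℝ F x) : (ℝ × ℝ) →ₗ[ℝ] (ℝ × ℝ))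

/-- The Piola matrix `A(x) = DF(x) / det DF(x)`. -/
def Amap (F : ℝ × ℝ → ℝ × ℝ) (x : ℝ × ℝ) : (ℝ × ℝ) →L[ℝ] (ℝ × ℝ) :=
  (jacDet F x)⁻¹ • fderiv ℝ F x

/-- `B(x) = det DF(x) · (DF(x))⁻¹`, the adjugate of `DF`. -/
def Bmap (F : ℝ × ℝ → ℝ × ℝ) (x : ℝ × ℝ) : (ℝ × ℝ) →L[ℝ] (ℝ × ℝ) :=
  jacDet F x • Ring.inverse (fderiv ℝ F x)

/-- `v` is the Piola transform of `v̂` under `F`. -/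
def IsPiola (F vh v : ℝ × ℝ → ℝ × ℝ) : Prop :=
  ∀ x ∈ closure Tref, v (F x) = Amap F x (vh x)

/-- The `W^{m,p}` seminorm over a set `S` (for `p < ∞`). -/
def semiLp {E : Type*} [NormedAddCommGroup E] [NormedSpace ℝ E]
    (m : ℕ) (p : ℝ) (w : ℝ × ℝ → E) (S : Set (ℝ × ℝ)) : ℝ :=
  (∫ x in S, ‖iteratedFDeriv ℝ m w x‖ ^ p) ^ (1 / p)

/-- The `W^{m,p}` norm over a set `S`: the sum of the seminorms up to order `m`. -/
def normWmp {E : Type*} [NormedAddCommGroup E] [NormedSpace ℝ E]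
    (m : ℕ) (p : ℝ) (w : ℝ × ℝ → E) (S : Set (ℝ × ℝ)) : ℝ :=
  ∑ j ∈ Finset.range (m + 1), semiLp j p w S

/-- The isoparametric bounds of order `k` with constants `CF, c₁, c₂` and parameter `h`. -/
def IsoparamBounds (k : ℕ) (CF c₁ c₂ h : ℝ) (F : ℝ × ℝ → ℝ × ℝ) : Prop :=
  InjOn F (closure Tref) ∧
  (∀ m : ℕ, m ≤ k → ∀ x ∈ Tref, ‖iteratedFDeriv ℝ m F x‖ ≤ CF * h ^ m) ∧
  (∀ m : ℕ, m ≤ k + 1 → ∀ y ∈ F '' Tref,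
    ‖iteratedFDeriv ℝ m (invFunOn F (closure Tref)) y‖ ≤ CF * h ^ (-(m : ℤ))) ∧
  (∀ x ∈ closure Tref, c₁ * h ^ 2 ≤ jacDet F x ∧ jacDet F x ≤ c₂ * h ^ 2)

/-- The (planar) divergence of a vector field. -/
def pdiv (w : ℝ × ℝ → ℝ × ℝ) (x : ℝ × ℝ) : ℝ :=
  (fderiv ℝ w x (1, 0)).1 + (fderiv ℝ w x (0, 1)).2

open MvPolynomial in
/-- Evaluation of a bivariate polynomial at a point of the plane. -/
def ev (P : MvPolynomial (Fin 2) ℝ) (x : ℝ × ℝ) : ℝ := MvPolynomial.eval ![x.1, x.2] P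

lemma ev_add (P Q : MvPolynomial (Fin 2) ℝ) (x) : ev (P + Q) x = ev P x + ev Q x := by simp [ev]
lemma ev_sub (P Q : MvPolynomial (Fin 2) ℝ) (x) : ev (P - Q) x = ev P x - ev Q x := by simp [ev]
lemma ev_mul (P Q : MvPolynomial (Fin 2) ℝ) (x) : ev (P * Q) x = ev P x * ev Q x := by simp [ev]
lemma ev_C (a : ℝ) (x) : ev (MvPolynomial.C a) x = a := by simp [ev]
lemma ev_smul (a : ℝ) (P : MvPolynomial (Fin 2) ℝ) (x) : ev (a • P) x = a * ev P x := by simp [ev]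

lemma ev_hasFDerivAt (P : MvPolynomial (Fin 2) ℝ) (x : ℝ × ℝ) :
    HasFDerivAt (ev P) (ev (MvPolynomial.pderiv 0 P) x • ContinuousLinearMap.fst ℝ ℝ ℝ +
      ev (MvPolynomial.pderiv 1 P) x • ContinuousLinearMap.snd ℝ ℝ ℝ) x := by
  induction P using MvPolynomial.induction_on with
  | C a =>
    have : ev (MvPolynomial.C a) = fun _ => a := by ext; simp [ev]
    rw [this]
    simpa [ev] using hasFDerivAt_const a x
  | add p q hp hq =>
    have h1 : ev (p + q) = fun x => ev p x + ev q x := by ext; simp [ev]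
    rw [h1]
    refine (hp.add hq).congr_fderiv ?_
    ext <;> simp [ev]
  | mul_X p n hp =>
    have h1 : ev (p * MvPolynomial.X n) = fun x => ev p x * ev (MvPolynomial.X n) x := by
      ext; simp [ev]
    rw [h1]
    fin_cases n
    · have h2 : HasFDerivAt (ev (MvPolynomial.X 0)) (ContinuousLinearMap.fst ℝ ℝ ℝ) x := by
        have : ev (MvPolynomial.X 0) = fun x => x.1 := by ext; simp [ev]
        rw [this]; exact hasFDerivAt_fst
      refine (hp.mul h2).congr_fderiv ?_
      ext <;> simp [ev, MvPolynomial.pderiv_X]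
    · have h2 : HasFDerivAt (ev (MvPolynomial.X 1)) (ContinuousLinearMap.snd ℝ ℝ ℝ) x := by
        have : ev (MvPolynomial.X 1) = fun x => x.2 := by ext; simp [ev]
        rw [this]; exact hasFDerivAt_snd
      refine (hp.mul h2).congr_fderiv ?_
      ext <;> simp [ev, MvPolynomial.pderiv_X]

lemma ev_contDiff (P : MvPolynomial (Fin 2) ℝ) {n : WithTop ℕ∞} : ContDiff ℝ n (ev P) := by
  induction P using MvPolynomial.induction_on with
  | C a =>
    have : ev (MvPolynomial.C a) = fun _ => a := by ext; simp [ev]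
    rw [this]; exact contDiff_const
  | add p q hp hq =>
    have h1 : ev (p + q) = fun x => ev p x + ev q x := by ext; simp [ev]
    rw [h1]; exact hp.add hq
  | mul_X p n hp =>
    have h1 : ev (p * MvPolynomial.X n) = fun x => ev p x * ev (MvPolynomial.X n) x := by
      ext; simp [ev]
    rw [h1]
    refine hp.mul ?_
    fin_cases n
    · have : ev (MvPolynomial.X 0) = fun x => x.1 := by ext; simp [ev]
      simp only [Fin.zero_eta]
      rw [this]; exact contDiff_fst
    · have : ev (MvPolynomial.X 1) = fun x => x.2 := by ext; simp [ev]
      simp only [Fin.mk_one]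
      rw [this]; exact contDiff_snd

lemma ev_continuous (P : MvPolynomial (Fin 2) ℝ) : Continuous (ev P) :=
  (ev_contDiff P (n := 0)).continuous

lemma totalDegree_pderiv_le' (P : MvPolynomial (Fin 2) ℝ) (a : Fin 2) :
    (MvPolynomial.pderiv a P).totalDegree ≤ P.totalDegree := by
  refine Finset.sup_le fun s hs => ?_
  rw [MvPolynomial.mem_support_iff, MvPolynomial.coeff_pderiv] at hs
  have h1 : s + Finsupp.single a 1 ∈ P.support := by
    rw [MvPolynomial.mem_support_iff]; exact left_ne_zero_of_mul hs
  refine le_trans ?_ (MvPolynomial.le_totalDegree h1)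
  rw [Finsupp.sum_fintype _ _ (by simp), Finsupp.sum_fintype _ _ (by simp)]
  exact Finset.sum_le_sum fun i _ => by simp

/-- A polynomial vanishing on a nonempty open set is zero. -/
lemma poly_eq_zero {K : Set (ℝ × ℝ)} (hK : IsOpen K) (hne : K.Nonempty)
    (P : MvPolynomial (Fin 2) ℝ) (h : ∀ x ∈ K, ev P x = 0) : P = 0 := by
  obtain ⟨x, hx⟩ := hne
  obtain ⟨u, v, hu, hv, hxu, hxv, huv⟩ := isOpen_prod_iff.1 hK x.1 x.2 hx
  refine MvPolynomial.funext_set ![u, v] ?_ ?_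
  · intro i
    fin_cases i
    · exact infinite_of_mem_nhds x.1 (hu.mem_nhds hxu)
    · exact infinite_of_mem_nhds x.2 (hv.mem_nhds hxv)
  · intro y hy
    have h0 := hy 0 trivial
    have h1 := hy 1 trivial
    have := h (y 0, y 1) (huv ⟨h0, h1⟩)
    rw [ev] at this
    simp only [map_zero]
    have hy' : ![(y 0, y 1).1, (y 0, y 1).2] = y := by
      ext i; fin_cases i <;> rfl
    rwa [hy'] at this

/-- Norm equivalence on the finite dimensional space of polynomials of degree at most `d`. -/
lemma polyBound {K : Set (ℝ × ℝ)} (hK : IsOpen K) (hne : K.Nonempty)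
    (hb : Bornology.IsBounded K) (q : ℝ) (hq : 1 ≤ q) (d : ℕ) :
    ∃ C : ℝ, 0 < C ∧ ∀ P : MvPolynomial (Fin 2) ℝ, P.totalDegree ≤ d → ∀ x ∈ K,
      |ev P x| ≤ C * (∫ y in K, |ev P y| ^ q) ^ (1 / q) ∧
      ∀ a, |ev (MvPolynomial.pderiv a P) x| ≤ C * (∫ y in K, |ev P y| ^ q) ^ (1 / q) := by
  classical
  have hq0 : 0 < q := by linarith
  let V := MvPolynomial.restrictTotalDegree (Fin 2) ℝ d
  let b := Module.finBasis ℝ V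
  let N := Module.finrank ℝ V
  let Q : ENNReal := ENNReal.ofReal q
  have : Fact (1 ≤ Q) := ⟨by simpa [Q] using hq⟩
  have hcomp : IsCompact (closure K) := hb.isCompact_closure
  have hμ : volume K < ⊤ := hb.measure_lt_top
  have : IsFiniteMeasure (volume.restrict K) := ⟨by simpa using hμ⟩
  have hbd : ∀ P : MvPolynomial (Fin 2) ℝ, ∃ B : ℝ, 0 ≤ B ∧ ∀ x ∈ K, |ev P x| ≤ B := by
    intro P
    obtain ⟨B, hB⟩ := hcomp.exists_bound_of_continuousOn (ev_continuous P).continuousOn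
    exact ⟨max B 0, le_max_right _ _, fun x hx =>
      (hB x (subset_closure hx)).trans (le_max_left _ _)⟩
  have hmem : ∀ P : MvPolynomial (Fin 2) ℝ, MemLp (ev P) Q (volume.restrict K) := by
    intro P
    obtain ⟨B, hB0, hB⟩ := hbd P
    refine MemLp.of_bound (ev_continuous P).aestronglyMeasurable B ?_
    exact (ae_restrict_iff' hK.measurableSet).2 (Filter.Eventually.of_forall hB)
  let Φ : (Fin N → ℝ) →ₗ[ℝ] MvPolynomial (Fin 2) ℝ :=
    V.subtype ∘ₗ (b.equivFun.symm : (Fin N → ℝ) →ₗ[ℝ] V)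
  let Ψ : MvPolynomial (Fin 2) ℝ →ₗ[ℝ] Lp ℝ Q (volume.restrict K) :=
    { toFun := fun P => (hmem P).toLp (ev P)
      map_add' := by
        intro P P'
        rw [← MemLp.toLp_add]
        congr 1; ext; simp [ev]
      map_smul' := by
        intro c P
        simp only [RingHom.id_apply]
        rw [← MemLp.toLp_const_smul]
        congr 1; ext; simp [ev] }
  have hΨ : ∀ P, ‖Ψ P‖ = (∫ y in K, |ev P y| ^ q) ^ (1 / q) := by
    intro P
    have hQ : Q.toReal = q := ENNReal.toReal_ofReal hq0.le
    have h0 : Q ≠ 0 := by simpa [Q] using hq0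
    have h1 : Q ≠ ⊤ := ENNReal.ofReal_ne_top
    change ‖(hmem P).toLp (ev P)‖ = _
    rw [Lp.norm_toLp, MemLp.eLpNorm_eq_integral_rpow_norm h0 h1 (hmem P), hQ,
      ENNReal.toReal_ofReal (Real.rpow_nonneg (integral_nonneg fun _ => Real.rpow_nonneg (norm_nonneg _) _) _)]
    simp [Real.norm_eq_abs]
  have hΦinj : Function.Injective Φ :=
    Subtype.val_injective.comp b.equivFun.symm.injective
  have hker : LinearMap.ker (Ψ ∘ₗ Φ) = ⊥ := by
    rw [LinearMap.ker_eq_bot']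
    intro c hc
    have h1 : (hmem (Φ c)).toLp (ev (Φ c)) = 0 := hc
    have h1' : ev (Φ c) =ᵐ[volume.restrict K] fun _ => 0 := by
      have e1 := (hmem (Φ c)).coeFn_toLp
      rw [h1] at e1
      exact e1.symm.trans (Lp.coeFn_zero _ _ _)
    have h2 : ∀ x ∈ K, ev (Φ c) x = 0 := by
      have := MeasureTheory.Measure.eqOn_open_of_ae_eq (μ := volume) (f := ev (Φ c)) (g := fun _ => 0)
        h1' hK (ev_continuous _).continuousOn continuousOn_const
      exact this
    have h3 := poly_eq_zero hK hne _ h2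
    exact hΦinj (by simpa using h3)
  obtain ⟨κ, hκ, hanti⟩ := LinearMap.exists_antilipschitzWith (Ψ ∘ₗ Φ) hker
  have hle : ∀ c, ‖c‖ ≤ κ * ‖Ψ (Φ c)‖ := by
    intro c
    have := hanti.le_mul_dist c 0
    simpa [dist_eq_norm] using this
  choose B hB0 hB using hbd
  let S : ℝ := ∑ i, (B (b i : MvPolynomial (Fin 2) ℝ) + ∑ a, B (MvPolynomial.pderiv a (b i : MvPolynomial (Fin 2) ℝ)))
  have hS0 : 0 ≤ S := Finset.sum_nonneg fun i _ =>
    add_nonneg (hB0 _) (Finset.sum_nonneg fun _ _ => hB0 _)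
  have hexp : ∀ c, Φ c = ∑ i, c i • (b i : MvPolynomial (Fin 2) ℝ) := by
    intro c
    simp [Φ, Module.Basis.equivFun_symm_apply]
    rfl
  have key : ∀ (D : MvPolynomial (Fin 2) ℝ →ₗ[ℝ] MvPolynomial (Fin 2) ℝ),
      (∀ i, B (D (b i)) ≤ B (b i) + ∑ a, B (MvPolynomial.pderiv a (b i : MvPolynomial (Fin 2) ℝ))) →
      ∀ c, ∀ x ∈ K, |ev (D (Φ c)) x| ≤ (κ * S + 1) * ‖Ψ (Φ c)‖ := by
    intro D hD c x hx
    have h1 : ev (D (Φ c)) x = ∑ i, c i * ev (D (b i)) x := by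
      rw [hexp]; simp [ev]
    calc |ev (D (Φ c)) x| ≤ ∑ i, |c i * ev (D (b i)) x| := by
          rw [h1]; exact Finset.abs_sum_le_sum_abs _ _
      _ ≤ ∑ i, ‖c‖ * (B (b i) + ∑ a, B (MvPolynomial.pderiv a (b i : MvPolynomial (Fin 2) ℝ))) := by
          refine Finset.sum_le_sum fun i _ => ?_
          rw [abs_mul]
          exact mul_le_mul (norm_le_pi_norm c i) ((hB _ x hx).trans (hD i)) (abs_nonneg _) (norm_nonneg _)
      _ = ‖c‖ * S := by rw [Finset.mul_sum]
      _ ≤ (κ * ‖Ψ (Φ c)‖) * S := mul_le_mul_of_nonneg_right (hle c) hS0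
      _ ≤ (κ * S + 1) * ‖Ψ (Φ c)‖ := by nlinarith [norm_nonneg (Ψ (Φ c))]
  refine ⟨κ * S + 1, by positivity, ?_⟩
  intro P hP x hx
  have hPV : P ∈ V := (MvPolynomial.mem_restrictTotalDegree _ _ _).2 hP
  have hPΦ : Φ (b.equivFun ⟨P, hPV⟩) = P := by simp [Φ]
  rw [← hΨ]
  constructor
  · have := key LinearMap.id (fun i => by
      simp only [LinearMap.id_apply, le_add_iff_nonneg_right]
      exact Finset.sum_nonneg fun _ _ => hB0 _) (b.equivFun ⟨P, hPV⟩) x hx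
    rwa [hPΦ] at this
  · intro a
    have := key (MvPolynomial.pderiv a).toLinearMap (fun i => by
      have := Finset.single_le_sum (f := fun a => B (MvPolynomial.pderiv a (b i : MvPolynomial (Fin 2) ℝ)))
        (fun a _ => hB0 _) (Finset.mem_univ a)
      have h2 := hB0 (b i : MvPolynomial (Fin 2) ℝ)
      have h3 : B ((MvPolynomial.pderiv a).toLinearMap (b i : MvPolynomial (Fin 2) ℝ)) = B (MvPolynomial.pderiv a (b i : MvPolynomial (Fin 2) ℝ)) := rfl
      rw [h3]
      linarith) (b.equivFun ⟨P, hPV⟩) x hx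
    rw [hPΦ] at this
    exact this

lemma polyDeriv {K : Set (ℝ × ℝ)} (hK : IsOpen K) (hne : K.Nonempty)
    (hb : Bornology.IsBounded K) (d : ℕ) :
    ∃ C : ℝ, 0 < C ∧ ∀ P : MvPolynomial (Fin 2) ℝ, P.totalDegree ≤ d → ∀ M : ℝ, 0 ≤ M →
      (∀ x ∈ K, |ev P x| ≤ M) → ∀ x ∈ K, ∀ a, |ev (MvPolynomial.pderiv a P) x| ≤ C * M := by
  obtain ⟨C, hC, h⟩ := polyBound hK hne hb 1 le_rfl d
  refine ⟨C * (volume.real K + 1), by positivity, ?_⟩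
  intro P hP M hM hPM x hx a
  have h1 := (h P hP x hx).2 a
  simp only [Real.rpow_one, div_one] at h1
  have h2 : ‖∫ y in K, |ev P y|‖ ≤ M * volume.real K :=
    norm_setIntegral_le_of_norm_le_const hb.measure_lt_top (fun x hx => by simpa using hPM x hx)
  have h3 := (le_abs_self _).trans h2
  calc _ ≤ _ := h1
    _ ≤ C * (M * volume.real K) := by gcongr
    _ ≤ C * (volume.real K + 1) * M := by nlinarith [mul_nonneg hC.le hM]
/-- The Jacobian determinant polynomial scaled by `h⁻²`. -/
def Jt (h : ℝ) (P1 P2 : MvPolynomial (Fin 2) ℝ) : MvPolynomial (Fin 2) ℝ :=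
  MvPolynomial.C (h ^ 2)⁻¹ * (MvPolynomial.pderiv 0 P1 * MvPolynomial.pderiv 1 P2 -
    MvPolynomial.pderiv 1 P1 * MvPolynomial.pderiv 0 P2)

/-- The two coordinate directions. -/
def dirv : Fin 2 → ℝ × ℝ := ![(1, 0), (0, 1)]

/-- The data extracted from the isoparametric bounds. -/
structure Dat (K : Set (ℝ × ℝ)) (k : ℕ) (CF c₁ c₂ h : ℝ) (F : ℝ × ℝ → ℝ × ℝ)
    (P1 P2 : MvPolynomial (Fin 2) ℝ) : Prop where
  h0 : 0 < h
  h1 : h ≤ 1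
  d1 : P1.totalDegree ≤ k
  d2 : P2.totalDegree ≤ k
  hF : F = fun x => (ev P1 x, ev P2 x)
  b1 : ∀ x ∈ K, ∀ a, |ev (MvPolynomial.pderiv a P1) x| ≤ CF * h
  b2 : ∀ x ∈ K, ∀ a, |ev (MvPolynomial.pderiv a P2) x| ≤ CF * h
  J1 : ∀ x ∈ K, c₁ ≤ ev (Jt h P1 P2) x
  J2 : ∀ x ∈ K, ev (Jt h P1 P2) x ≤ c₂
  inj : InjOn F K

/-- `w ∘ F` equals a polynomial divided by a power of `J`. -/
def PRep (K : Set (ℝ × ℝ)) (J : MvPolynomial (Fin 2) ℝ) (F : ℝ × ℝ → ℝ × ℝ) (w : ℝ × ℝ → ℝ)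
    (n d : ℕ) (M : ℝ) : Prop :=
  ∃ P : MvPolynomial (Fin 2) ℝ, P.totalDegree ≤ d ∧ (∀ x ∈ K, |ev P x| ≤ M) ∧
    ∀ x ∈ K, w (F x) * ev J x ^ n = ev P x

lemma td_mul {P Q : MvPolynomial (Fin 2) ℝ} {a b c : ℕ} (hP : P.totalDegree ≤ a)
    (hQ : Q.totalDegree ≤ b) (h : a + b ≤ c) : (P * Q).totalDegree ≤ c :=
  (MvPolynomial.totalDegree_mul P Q).trans (by omega)

lemma td_Cmul {P : MvPolynomial (Fin 2) ℝ} {c : ℕ} (r : ℝ) (hP : P.totalDegree ≤ c) :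
    (MvPolynomial.C r * P).totalDegree ≤ c :=
  td_mul (a := 0) (by simp) hP (by simp)

lemma td_add {P Q : MvPolynomial (Fin 2) ℝ} {c : ℕ} (hP : P.totalDegree ≤ c)
    (hQ : Q.totalDegree ≤ c) : (P + Q).totalDegree ≤ c :=
  (MvPolynomial.totalDegree_add P Q).trans (max_le hP hQ)

lemma td_sub {P Q : MvPolynomial (Fin 2) ℝ} {c : ℕ} (hP : P.totalDegree ≤ c)
    (hQ : Q.totalDegree ≤ c) : (P - Q).totalDegree ≤ c :=
  (MvPolynomial.totalDegree_sub P Q).trans (max_le hP hQ)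

lemma td_pd {P : MvPolynomial (Fin 2) ℝ} {c : ℕ} (hP : P.totalDegree ≤ c) (a : Fin 2) :
    (MvPolynomial.pderiv a P).totalDegree ≤ c := (totalDegree_pderiv_le' P a).trans hP

lemma Jt_deg {k : ℕ} {P1 P2 : MvPolynomial (Fin 2) ℝ} (h : ℝ) (h1 : P1.totalDegree ≤ k)
    (h2 : P2.totalDegree ≤ k) : (Jt h P1 P2).totalDegree ≤ 2 * k :=
  td_Cmul _ (td_sub (td_mul (td_pd h1 0) (td_pd h2 1) (by omega))
    (td_mul (td_pd h1 1) (td_pd h2 0) (by omega)))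

/-- The derivative of a polynomial map. -/
def DP (P1 P2 : MvPolynomial (Fin 2) ℝ) (x : ℝ × ℝ) : ℝ × ℝ →L[ℝ] ℝ × ℝ :=
  (ev (MvPolynomial.pderiv 0 P1) x • ContinuousLinearMap.fst ℝ ℝ ℝ +
      ev (MvPolynomial.pderiv 1 P1) x • ContinuousLinearMap.snd ℝ ℝ ℝ).prod
  (ev (MvPolynomial.pderiv 0 P2) x • ContinuousLinearMap.fst ℝ ℝ ℝ +
      ev (MvPolynomial.pderiv 1 P2) x • ContinuousLinearMap.snd ℝ ℝ ℝ)

lemma DP_apply (P1 P2 : MvPolynomial (Fin 2) ℝ) (x u : ℝ × ℝ) : DP P1 P2 x u =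
    (ev (MvPolynomial.pderiv 0 P1) x * u.1 + ev (MvPolynomial.pderiv 1 P1) x * u.2,
     ev (MvPolynomial.pderiv 0 P2) x * u.1 + ev (MvPolynomial.pderiv 1 P2) x * u.2) := by
  simp [DP]

lemma Dat.hasFDerivAt {K k CF c₁ c₂ h F P1 P2} (D : Dat K k CF c₁ c₂ h F P1 P2) (x : ℝ × ℝ) :
    HasFDerivAt F (DP P1 P2 x) x := by
  rw [D.hF]
  exact (ev_hasFDerivAt P1 x).prodMk (ev_hasFDerivAt P2 x)

lemma ev_Jt {h : ℝ} (h0 : 0 < h) (P1 P2 : MvPolynomial (Fin 2) ℝ) (x : ℝ × ℝ) :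
    h ^ 2 * ev (Jt h P1 P2) x = ev (MvPolynomial.pderiv 0 P1) x * ev (MvPolynomial.pderiv 1 P2) x -
    ev (MvPolynomial.pderiv 1 P1) x * ev (MvPolynomial.pderiv 0 P2) x := by
  rw [Jt, ev_mul, ev_C, ev_sub, ev_mul, ev_mul]
  field_simp

/-- One differentiation step along a direction `e`. -/
lemma step_core {K : Set (ℝ × ℝ)} (hK : IsOpen K) {k : ℕ} {CF c₁ c₂ : ℝ} (hCF : 0 < CF)
    (hc₁ : 0 < c₁) (n d : ℕ) (Cd CJ : ℝ)
    (hCd : ∀ P : MvPolynomial (Fin 2) ℝ, P.totalDegree ≤ d → ∀ M : ℝ, 0 ≤ M →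
      (∀ x ∈ K, |ev P x| ≤ M) → ∀ x ∈ K, ∀ a, |ev (MvPolynomial.pderiv a P) x| ≤ Cd * M)
    (hCJ : ∀ P : MvPolynomial (Fin 2) ℝ, P.totalDegree ≤ 2 * k → ∀ M : ℝ, 0 ≤ M →
      (∀ x ∈ K, |ev P x| ≤ M) → ∀ x ∈ K, ∀ a, |ev (MvPolynomial.pderiv a P) x| ≤ CJ * M)
    {h : ℝ} {F : ℝ × ℝ → ℝ × ℝ} {P1 P2 : MvPolynomial (Fin 2) ℝ}
    (D : Dat K k CF c₁ c₂ h F P1 P2) (w : ℝ × ℝ → ℝ) (M : ℝ) (hM : 0 ≤ M)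
    (hw : ∀ x ∈ K, DifferentiableAt ℝ w (F x)) (hR : PRep K (Jt h P1 P2) F w n d M)
    (e : ℝ × ℝ) (u1 u2 : MvPolynomial (Fin 2) ℝ) (hu1 : u1.totalDegree ≤ k)
    (hu2 : u2.totalDegree ≤ k) (hb1 : ∀ x ∈ K, |ev u1 x| ≤ CF * h)
    (hb2 : ∀ x ∈ K, |ev u2 x| ≤ CF * h)
    (hu : ∀ x ∈ K, DP P1 P2 x (ev u1 x, ev u2 x) = (h ^ 2 * ev (Jt h P1 P2) x) • e) :
    PRep K (Jt h P1 P2) F (fun y => fderiv ℝ w y e) (n + 2) (d + 3 * k)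
      ((2 * c₂ * CF * (Cd + n * CJ)) * h⁻¹ * M) := by
  obtain ⟨P, hPd, hPM, hPw⟩ := hR
  set J := Jt h P1 P2 with hJ
  have hJd : J.totalDegree ≤ 2 * k := Jt_deg h D.d1 D.d2
  have h0 := D.h0
  refine ⟨MvPolynomial.C (h ^ 2)⁻¹ *
    (J * (MvPolynomial.pderiv 0 P * u1 + MvPolynomial.pderiv 1 P * u2) -
      MvPolynomial.C (n : ℝ) * (P * (MvPolynomial.pderiv 0 J * u1 + MvPolynomial.pderiv 1 J * u2))),
    ?_, ?_, ?_⟩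
  · refine td_Cmul _ (td_sub ?_ (td_Cmul _ ?_))
    · exact td_mul hJd (td_add (td_mul (td_pd hPd 0) hu1 le_rfl) (td_mul (td_pd hPd 1) hu2 le_rfl))
        (by omega)
    · exact td_mul hPd (td_add (td_mul (td_pd hJd 0) hu1 le_rfl) (td_mul (td_pd hJd 1) hu2 le_rfl))
        (by omega)
  · intro x hx
    have hJpos : 0 < ev J x := hc₁.trans_le (D.J1 x hx)
    have hJle : ev J x ≤ c₂ := D.J2 x hx
    have hc₂ : 0 < c₂ := hJpos.trans_le hJle
    have hJabs : ∀ x ∈ K, |ev J x| ≤ c₂ := fun x hx => by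
      rw [abs_of_pos (hc₁.trans_le (D.J1 x hx))]; exact D.J2 x hx
    have hp := hCd P hPd M hM hPM x hx
    have hj := hCJ J hJd c₂ hc₂.le hJabs x hx
    have hCF' : 0 ≤ CF * h := by positivity
    have hCd0 : 0 ≤ Cd * M := (abs_nonneg _).trans (hp 0)
    have hCJ0 : 0 ≤ CJ * c₂ := (abs_nonneg _).trans (hj 0)
    have e1 : ∀ (Q : MvPolynomial (Fin 2) ℝ) (B : ℝ), 0 ≤ B →
        (∀ a, |ev (MvPolynomial.pderiv a Q) x| ≤ B) →
        |ev (MvPolynomial.pderiv 0 Q) x * ev u1 x + ev (MvPolynomial.pderiv 1 Q) x * ev u2 x| ≤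
          2 * (B * (CF * h)) := by
      intro Q B hB hQ
      refine (abs_add_le _ _).trans ?_
      rw [abs_mul, abs_mul]
      have := mul_le_mul (hQ 0) (hb1 x hx) (abs_nonneg _) hB
      have := mul_le_mul (hQ 1) (hb2 x hx) (abs_nonneg _) hB
      linarith
    have e2 := e1 P _ hCd0 hp
    have e3 := e1 J _ hCJ0 hj
    simp only [ev_mul, ev_sub, ev_add, ev_C]
    rw [abs_mul, abs_of_pos (by positivity : (0 : ℝ) < (h ^ 2)⁻¹)]
    have e4 : |ev J x * (ev (MvPolynomial.pderiv 0 P) x * ev u1 x + ev (MvPolynomial.pderiv 1 P) x * ev u2 x) -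
        n * (ev P x * (ev (MvPolynomial.pderiv 0 J) x * ev u1 x + ev (MvPolynomial.pderiv 1 J) x * ev u2 x))|
        ≤ c₂ * (2 * (Cd * M * (CF * h))) + n * (M * (2 * (CJ * c₂ * (CF * h)))) := by
      refine (abs_sub _ _).trans ?_
      rw [abs_mul, abs_mul (n : ℝ), abs_mul (ev P x), Nat.abs_cast]
      have := hJabs x hx
      have := hPM x hx
      gcongr
    calc _ ≤ (h ^ 2)⁻¹ * (c₂ * (2 * (Cd * M * (CF * h))) + n * (M * (2 * (CJ * c₂ * (CF * h))))) := by
          gcongr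
      _ = _ := by field_simp
  · intro x hx
    have hFx := D.hasFDerivAt x
    have hwx := (hw x hx).hasFDerivAt
    have hcomp := hwx.comp x hFx
    have hprod := hcomp.mul ((ev_hasFDerivAt J x).pow n)
    have heq : (w ∘ F * (ev J) ^ n) =ᶠ[nhds x] ev P := by
      filter_upwards [hK.mem_nhds hx] with y hy
      exact hPw y hy
    have huniq := (hprod.congr_of_eventuallyEq heq.symm).unique (ev_hasFDerivAt P x)
    have happ := congrArg (fun L => L (ev u1 x, ev u2 x)) huniq
    have hval := hPw x hx
    simp only [Function.comp, add_apply, smul_apply,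
      ContinuousLinearMap.comp_apply, hu x hx, map_smul, smul_eq_mul, ContinuousLinearMap.coe_fst',
      ContinuousLinearMap.coe_snd', nsmul_eq_mul] at happ
    simp only [ev_mul, ev_sub, ev_add, ev_C]
    rw [← happ, ← hval]
    have hn : (n : ℝ) * ev J x ^ (n - 1) * ev J x = n * ev J x ^ n := by
      cases n with
      | zero => simp
      | succ m => simp [pow_succ, mul_assoc]
    have hh : (h ^ 2)⁻¹ * h ^ 2 = 1 := by field_simp
    set A := ev (MvPolynomial.pderiv 0 J) x * ev u1 x + ev (MvPolynomial.pderiv 1 J) x * ev u2 x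
    linear_combination (-(h^2)⁻¹ * w (F x) * A) * hn - (ev J x ^ (n+2) * fderiv ℝ w (F x) e) * hh

lemma step {K : Set (ℝ × ℝ)} (hK : IsOpen K) (hne : K.Nonempty)
    (hb : Bornology.IsBounded K) (k : ℕ) {CF c₁ c₂ : ℝ} (hCF : 0 < CF)
    (hc₁ : 0 < c₁) (hc₂ : 0 < c₂) (n d : ℕ) :
    ∃ C : ℝ, 0 < C ∧ ∀ (h : ℝ) (F : ℝ × ℝ → ℝ × ℝ) (P1 P2 : MvPolynomial (Fin 2) ℝ),
    Dat K k CF c₁ c₂ h F P1 P2 → ∀ (w : ℝ × ℝ → ℝ) (M : ℝ), 0 ≤ M →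
    (∀ x ∈ K, DifferentiableAt ℝ w (F x)) → PRep K (Jt h P1 P2) F w n d M →
    ∀ a, PRep K (Jt h P1 P2) F (fun y => fderiv ℝ w y (dirv a)) (n + 2) (d + 3 * k)
      (C * h⁻¹ * M) := by
  obtain ⟨Cd, hCd0, hCd⟩ := polyDeriv hK hne hb d
  obtain ⟨CJ, hCJ0, hCJ⟩ := polyDeriv hK hne hb (2 * k)
  refine ⟨2 * c₂ * CF * (Cd + n * CJ), by positivity, ?_⟩
  intro h F P1 P2 D w M hM hw hR a
  fin_cases a
  · refine step_core hK hCF hc₁ n d Cd CJ hCd hCJ D w M hM hw hR (dirv 0)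
      (MvPolynomial.pderiv 1 P2) (- MvPolynomial.pderiv 0 P2) (td_pd D.d2 1)
      (by rw [MvPolynomial.totalDegree_neg]; exact td_pd D.d2 0) (fun x hx => D.b2 x hx 1)
      (fun x hx => by simpa [ev] using D.b2 x hx 0) ?_
    intro x hx
    rw [DP_apply, ev_Jt D.h0]
    ext <;> simp [dirv, ev] <;> ring
  · refine step_core hK hCF hc₁ n d Cd CJ hCd hCJ D w M hM hw hR (dirv 1)
      (- MvPolynomial.pderiv 1 P1) (MvPolynomial.pderiv 0 P1)
      (by rw [MvPolynomial.totalDegree_neg]; exact td_pd D.d1 1) (td_pd D.d1 0)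
      (fun x hx => by simpa [ev] using D.b1 x hx 1) (fun x hx => D.b1 x hx 0) ?_
    intro x hx
    rw [DP_apply, ev_Jt D.h0]
    ext <;> simp [dirv, ev] <;> ring

/-- Iterated directional derivatives along coordinate directions. -/
def dirD : List (Fin 2) → (ℝ × ℝ → ℝ) → (ℝ × ℝ → ℝ)
  | [], w => w
  | a :: l, w => fun y => fderiv ℝ (dirD l w) y (dirv a)

lemma dirD_append (l1 l2 : List (Fin 2)) (w : ℝ × ℝ → ℝ) :
    dirD (l1 ++ l2) w = dirD l1 (dirD l2 w) := by
  induction l1 with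
  | nil => rfl
  | cons a l ih => simp [dirD, ih]

open scoped ContDiff in
lemma dirD_contDiffOn {Ω : Set (ℝ × ℝ)} (hΩ : IsOpen Ω) {w : ℝ × ℝ → ℝ} (hw : ContDiffOn ℝ ∞ w Ω)
    (l : List (Fin 2)) : ContDiffOn ℝ ∞ (dirD l w) Ω := by
  induction l with
  | nil => exact hw
  | cons a l ih => exact (ih.fderiv_of_isOpen hΩ (by simp)).clm_apply contDiffOn_const

open scoped ContDiff in
lemma iter {K : Set (ℝ × ℝ)} (hK : IsOpen K) (hne : K.Nonempty)
    (hb : Bornology.IsBounded K) (k : ℕ) {CF c₁ c₂ : ℝ} (hCF : 0 < CF)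
    (hc₁ : 0 < c₁) (hc₂ : 0 < c₂) (n d r : ℕ) :
    ∃ C : ℝ, 0 < C ∧ ∀ (h : ℝ) (F : ℝ × ℝ → ℝ × ℝ) (P1 P2 : MvPolynomial (Fin 2) ℝ),
    Dat K k CF c₁ c₂ h F P1 P2 → IsOpen (F '' K) → ∀ (w : ℝ × ℝ → ℝ) (M : ℝ), 0 ≤ M →
    ContDiffOn ℝ ∞ w (F '' K) → PRep K (Jt h P1 P2) F w n d M →
    ∀ l : List (Fin 2), l.length = r →
      PRep K (Jt h P1 P2) F (dirD l w) (n + 2 * r) (d + 3 * k * r) (C * h⁻¹ ^ r * M) := by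
  induction r with
  | zero =>
    refine ⟨1, one_pos, ?_⟩
    intro h F P1 P2 D hΩ w M hM hw hR l hl
    rw [List.length_eq_zero_iff] at hl
    subst hl
    simpa [dirD] using hR
  | succ r ih =>
    obtain ⟨C1, hC1, H1⟩ := ih
    obtain ⟨C2, hC2, H2⟩ := step hK hne hb k hCF hc₁ hc₂ (n + 2 * r) (d + 3 * k * r)
    refine ⟨C2 * C1, by positivity, ?_⟩
    intro h F P1 P2 D hΩ w M hM hw hR l hl
    cases l with
    | nil => simp at hl
    | cons a l =>
      have hl' : l.length = r := by simpa using hl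
      have h0 := D.h0
      have hs := H1 h F P1 P2 D hΩ w M hM hw hR l hl'
      have hcd := dirD_contDiffOn hΩ hw l
      have := H2 h F P1 P2 D (dirD l w) _ (by positivity) (fun x hx =>
        (hcd.contDiffAt (hΩ.mem_nhds (mem_image_of_mem F hx))).differentiableAt (by simp)) hs a
      have e1 : n + 2 * (r + 1) = n + 2 * r + 2 := by ring
      have e2 : d + 3 * k * (r + 1) = d + 3 * k * r + 3 * k := by ring
      have e3 : C2 * C1 * h⁻¹ ^ (r + 1) * M = C2 * h⁻¹ * (C1 * h⁻¹ ^ r * M) := by ring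
      rw [e1, e2, e3]
      exact this

open scoped ContDiff in
lemma dirD_iterated {Ω : Set (ℝ × ℝ)} (hΩ : IsOpen Ω) {w : ℝ × ℝ → ℝ} (hw : ContDiffOn ℝ ∞ w Ω)
    (n : ℕ) (a : Fin n → Fin 2) : ∀ y ∈ Ω,
    iteratedFDeriv ℝ n w y (fun i => dirv (a i)) = dirD (List.ofFn a) w y := by
  induction n with
  | zero => intro y hy; simp [dirD]
  | succ n ih =>
    intro y hy
    rw [List.ofFn_succ, iteratedFDeriv_succ_apply_left]
    have hd : DifferentiableAt ℝ (iteratedFDeriv ℝ n w) y := by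
      refine (hw.contDiffAt (hΩ.mem_nhds hy)).differentiableAt_iteratedFDeriv ?_
      exact_mod_cast WithTop.coe_lt_top _
    have h1 : (fun z => iteratedFDeriv ℝ n w z (Fin.tail fun i => dirv (a i))) =ᶠ[nhds y]
        dirD (List.ofFn fun i => a i.succ) w := by
      filter_upwards [hΩ.mem_nhds hy] with z hz
      exact ih (fun i => a i.succ) z hz
    have h2 := h1.fderiv_eq (𝕜 := ℝ)
    simp only [dirD]
    rw [← h2]
    rw [fderiv_continuousMultilinear_apply_const hd]
    rfl

/-- Bound of a multilinear map by its values on coordinate directions. -/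
lemma multilin_bound {n : ℕ} (f : ContinuousMultilinearMap ℝ (fun _ : Fin n => ℝ × ℝ) (ℝ × ℝ))
    (B : ℝ) (hB : 0 ≤ B) (hf : ∀ a : Fin n → Fin 2, ‖f (fun i => dirv (a i))‖ ≤ B) :
    ‖f‖ ≤ 2 ^ n * B := by
  refine f.opNorm_le_bound (by positivity) fun x => ?_
  let c : ℝ × ℝ → Fin 2 → ℝ := fun z => ![z.1, z.2]
  have hx : x = fun i => ∑ j : Fin 2, c (x i) j • dirv j := by
    ext i <;> simp [c, dirv]
  have hc : ∀ z j, |c z j| ≤ ‖z‖ := by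
    intro z j
    fin_cases j
    · exact norm_fst_le z
    · exact norm_snd_le z
  have e1 : f x = ∑ a : Fin n → Fin 2, (∏ i, c (x i) (a i)) • f (fun i => dirv (a i)) := by
    conv_lhs => rw [hx]
    rw [f.map_sum]
    refine Finset.sum_congr rfl fun a _ => ?_
    rw [f.map_smul_univ]
  rw [e1]
  calc _ ≤ ∑ a : Fin n → Fin 2, ‖(∏ i, c (x i) (a i)) • f (fun i => dirv (a i))‖ :=
        norm_sum_le _ _
    _ ≤ ∑ a : Fin n → Fin 2, (∏ i, ‖x i‖) * B := by
        refine Finset.sum_le_sum fun a _ => ?_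
        rw [norm_smul, norm_prod]
        exact mul_le_mul (Finset.prod_le_prod (fun _ _ => norm_nonneg _) fun i _ => hc _ _) (hf a)
          (norm_nonneg _) (Finset.prod_nonneg fun _ _ => norm_nonneg _)
    _ = _ := by simp; ring
lemma det_DP {h : ℝ} (h0 : 0 < h) (P1 P2 : MvPolynomial (Fin 2) ℝ) (x : ℝ × ℝ) :
    LinearMap.det ((DP P1 P2 x : ℝ × ℝ →L[ℝ] ℝ × ℝ) : (ℝ × ℝ) →ₗ[ℝ] (ℝ × ℝ)) =
      h ^ 2 * ev (Jt h P1 P2) x := by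
  rw [ev_Jt h0, ← LinearMap.det_toMatrix (Module.Basis.finTwoProd ℝ), Matrix.det_fin_two]
  simp [LinearMap.toMatrix_apply, DP_apply]

section
variable {K : Set (ℝ × ℝ)} {k : ℕ} {CF c₁ c₂ h : ℝ} {F : ℝ × ℝ → ℝ × ℝ}
  {P1 P2 : MvPolynomial (Fin 2) ℝ}

lemma Dat.cov (D : Dat K k CF c₁ c₂ h F P1 P2) (hK : IsOpen K) (hc₁ : 0 < c₁)
    (g : ℝ × ℝ → ℝ) :
    ∫ y in F '' K, g y = ∫ x in K, (h ^ 2 * ev (Jt h P1 P2) x) * g (F x) := by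
  rw [integral_image_eq_integral_abs_det_fderiv_smul volume hK.measurableSet
    (fun x _ => (D.hasFDerivAt x).hasFDerivWithinAt) D.inj]
  refine setIntegral_congr_fun hK.measurableSet fun x hx => ?_
  have h1 : (DP P1 P2 x).det = h ^ 2 * ev (Jt h P1 P2) x := det_DP D.h0 P1 P2 x
  have h2 : 0 < ev (Jt h P1 P2) x := hc₁.trans_le (D.J1 x hx)
  have h3 := D.h0
  simp only [smul_eq_mul, h1]
  rw [abs_of_pos (by positivity)]

open scoped ContDiff in
lemma Dat.contDiff (D : Dat K k CF c₁ c₂ h F P1 P2) : ContDiff ℝ ∞ F := by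
  rw [D.hF]
  exact (ev_contDiff P1).prodMk (ev_contDiff P2)

lemma Dat.equiv (D : Dat K k CF c₁ c₂ h F P1 P2) (hc₁ : 0 < c₁) {x : ℝ × ℝ} (hx : x ∈ K) :
    ∃ E : (ℝ × ℝ) ≃L[ℝ] (ℝ × ℝ), HasFDerivAt F (E : ℝ × ℝ →L[ℝ] ℝ × ℝ) x := by
  have h2 : 0 < ev (Jt h P1 P2) x := hc₁.trans_le (D.J1 x hx)
  have h3 := D.h0
  have hdet : (DP P1 P2 x).det ≠ 0 := by
    have h1 : (DP P1 P2 x).det = h ^ 2 * ev (Jt h P1 P2) x := det_DP D.h0 P1 P2 x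
    rw [h1]; positivity
  refine ⟨(DP P1 P2 x).toContinuousLinearEquivOfDetNeZero hdet, ?_⟩
  simpa using D.hasFDerivAt x

open scoped ContDiff in
lemma Dat.isOpen (D : Dat K k CF c₁ c₂ h F P1 P2) (hK : IsOpen K) (hc₁ : 0 < c₁) :
    IsOpen (F '' K) := by
  rw [isOpen_iff_mem_nhds]
  rintro _ ⟨x, hx, rfl⟩
  obtain ⟨E, hE⟩ := D.equiv hc₁ hx
  have hs := D.contDiff.contDiffAt.hasStrictFDerivAt' hE (by simp)
  rw [← hs.map_nhds_eq_of_equiv]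
  exact Filter.image_mem_map (hK.mem_nhds hx)

open scoped ContDiff in
lemma Dat.contDiffOn (D : Dat K k CF c₁ c₂ h F P1 P2) (hK : IsOpen K) (hc₁ : 0 < c₁)
    (v G : ℝ × ℝ → ℝ × ℝ) (hG : ∀ x ∈ K, ContDiffAt ℝ ∞ G x) (hv : ∀ x ∈ K, v (F x) = G x) :
    ContDiffOn ℝ ∞ v (F '' K) := by
  rintro _ ⟨x, hx, rfl⟩
  refine ContDiffAt.contDiffWithinAt ?_
  obtain ⟨E, hE⟩ := D.equiv hc₁ hx
  have hFx : ContDiffAt ℝ ∞ F x := D.contDiff.contDiffAt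
  have hs := hFx.hasStrictFDerivAt' hE (by simp)
  have hL := hFx.to_localInverse hE (by simp)
  have hLx := hFx.localInverse_apply_image hE (by simp)
  set L := hFx.localInverse hE (by simp) with hLdef
  have hright : ∀ᶠ y in nhds (F x), F (L y) = y := hs.eventually_right_inverse
  have hmem : ∀ᶠ y in nhds (F x), L y ∈ K := by
    have := hL.continuousAt
    rw [ContinuousAt, hLx] at this
    exact this.eventually (hK.mem_nhds hx)
  have hcomp : ContDiffAt ℝ ∞ (G ∘ L) (F x) := by
    refine ContDiffAt.comp _ ?_ hL
    rw [hLx]; exact hG x hx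
  refine hcomp.congr_of_eventuallyEq ?_
  filter_upwards [hright, hmem] with y h1 h2
  rw [Function.comp, ← hv _ h2, h1]

lemma PRep.le (D : Dat K k CF c₁ c₂ h F P1 P2) (hc₁ : 0 < c₁) {w : ℝ × ℝ → ℝ} {n d : ℕ} {M : ℝ}
    (hR : PRep K (Jt h P1 P2) F w n d M) {x : ℝ × ℝ} (hx : x ∈ K) :
    |w (F x)| ≤ M / c₁ ^ n := by
  obtain ⟨P, -, hM, hP⟩ := hR
  have h1 := hM x hx
  have hJ := D.J1 x hx
  have hJ0 : 0 < ev (Jt h P1 P2) x := hc₁.trans_le hJ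
  rw [← hP x hx, abs_mul, abs_pow, abs_of_pos hJ0] at h1
  rw [le_div_iff₀ (by positivity)]
  refine le_trans ?_ h1
  gcongr

end

open scoped ContDiff in
lemma comp_dirD {Ω : Set (ℝ × ℝ)} (hΩ : IsOpen Ω) {v : ℝ × ℝ → ℝ × ℝ} (hv : ContDiffOn ℝ ∞ v Ω)
    (L : ℝ × ℝ →L[ℝ] ℝ) (n : ℕ) (a : Fin n → Fin 2) {y : ℝ × ℝ} (hy : y ∈ Ω) :
    L (iteratedFDeriv ℝ n v y (fun i => dirv (a i))) =
      dirD (List.ofFn a) (fun z => L (v z)) y := by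
  have hLv : ContDiffOn ℝ ∞ (fun z => L (v z)) Ω := L.contDiff.comp_contDiffOn hv
  rw [← dirD_iterated hΩ hLv n a y hy]
  have h1 := L.iteratedFDeriv_comp_left (hv.contDiffAt (hΩ.mem_nhds hy)) (i := n)
    (by exact_mod_cast le_top)
  have h2 : iteratedFDeriv ℝ n (fun z => L (v z)) y = iteratedFDeriv ℝ n (⇑L ∘ v) y := rfl
  rw [h2, h1]
  rfl

/-- The two coordinate projections. -/
def prj : Fin 2 → (ℝ × ℝ →L[ℝ] ℝ) :=
  ![ContinuousLinearMap.fst ℝ ℝ ℝ, ContinuousLinearMap.snd ℝ ℝ ℝ]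

lemma norm_le_prj (z : ℝ × ℝ) (B : ℝ) (h : ∀ c, |prj c z| ≤ B) : ‖z‖ ≤ B := by
  rw [Prod.norm_def]
  exact max_le (h 0) (h 1)

lemma prj_le (z : ℝ × ℝ) (c : Fin 2) : |prj c z| ≤ ‖z‖ := by
  fin_cases c
  · exact norm_fst_le z
  · exact norm_snd_le z

lemma norm_dirv (a : Fin 2) : ‖dirv a‖ ≤ 1 := by
  fin_cases a <;> simp [dirv, Prod.norm_def]

open scoped ContDiff in
lemma iteratedFDeriv_le {Ω : Set (ℝ × ℝ)} (hΩ : IsOpen Ω) {v : ℝ × ℝ → ℝ × ℝ}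
    (hv : ContDiffOn ℝ ∞ v Ω) (n : ℕ) (B : ℝ) (hB : 0 ≤ B) {y : ℝ × ℝ} (hy : y ∈ Ω)
    (h : ∀ l : List (Fin 2), l.length = n → ∀ c, |dirD l (fun z => prj c (v z)) y| ≤ B) :
    ‖iteratedFDeriv ℝ n v y‖ ≤ 2 ^ n * B := by
  refine multilin_bound _ B hB fun a => norm_le_prj _ _ fun c => ?_
  rw [comp_dirD hΩ hv _ _ _ hy]
  exact h _ (by simp) c

open scoped ContDiff in
lemma dirD_le_norm {Ω : Set (ℝ × ℝ)} (hΩ : IsOpen Ω) {v : ℝ × ℝ → ℝ × ℝ}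
    (hv : ContDiffOn ℝ ∞ v Ω) {y : ℝ × ℝ} (hy : y ∈ Ω) (l : List (Fin 2)) (c : Fin 2) :
    |dirD l (fun z => prj c (v z)) y| ≤ ‖iteratedFDeriv ℝ l.length v y‖ := by
  have h1 := comp_dirD hΩ hv (prj c) l.length l.get hy
  rw [List.ofFn_get] at h1
  rw [← h1]
  refine (prj_le _ _).trans ?_
  refine (ContinuousMultilinearMap.le_opNorm _ _).trans ?_
  refine mul_le_of_le_one_right (norm_nonneg _) ?_
  exact Finset.prod_le_one (fun _ _ => norm_nonneg _) fun i _ => norm_dirv _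

open scoped ContDiff in
lemma key {K : Set (ℝ × ℝ)} (hK : IsOpen K) (hne : K.Nonempty)
    (hb : Bornology.IsBounded K) (k : ℕ) {CF c₁ c₂ : ℝ} (hCF : 0 < CF)
    (hc₁ : 0 < c₁) (hc₂ : 0 < c₂) (q : ℝ) (hq : 1 ≤ q) (m r : ℕ) :
    ∃ C : ℝ, 0 < C ∧ ∀ (h : ℝ) (F : ℝ × ℝ → ℝ × ℝ) (P1 P2 : MvPolynomial (Fin 2) ℝ),
    Dat K k CF c₁ c₂ h F P1 P2 → ∀ v : ℝ × ℝ → ℝ × ℝ, ContDiffOn ℝ ∞ v (F '' K) →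
    ∀ M : ℝ, 0 ≤ M → (∀ c, PRep K (Jt h P1 P2) F (fun z => prj c (v z)) 1 (2 * k) M) →
    ∀ y ∈ F '' K, ‖iteratedFDeriv ℝ (m + r) v y‖ ≤
      C * (h⁻¹ ^ r * ((h ^ 2)⁻¹) ^ (1 / q)) * semiLp m q v (F '' K) := by
  have hq0 : 0 < q := by linarith
  obtain ⟨C1, hC1, H1⟩ := iter hK hne hb k hCF hc₁ hc₂ 1 (2 * k) m
  set n := 1 + 2 * m with hn
  set d := 2 * k + 3 * k * m with hd
  obtain ⟨C2, hC2, H2⟩ := iter hK hne hb k hCF hc₁ hc₂ n d r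
  obtain ⟨C3, hC3, H3⟩ := polyBound hK hne hb q hq d
  refine ⟨2 ^ (m + r) * (C2 * (C3 * (c₂ ^ n * c₁⁻¹ ^ (1 / q))) / c₁ ^ (n + 2 * r)), by positivity, ?_⟩
  intro h F P1 P2 D v hv M hM hR
  have h0 := D.h0
  have hΩ := D.isOpen hK hc₁
  have hvc : ∀ c, ContDiffOn ℝ ∞ (fun z => prj c (v z)) (F '' K) :=
    fun c => (prj c).contDiff.comp_contDiffOn hv
  have R1 := fun c => H1 h F P1 P2 D hΩ _ M hM (hvc c) (hR c)
  set S := semiLp m q v (F '' K) with hS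
  have hcov := D.cov hK hc₁ (fun y => ‖iteratedFDeriv ℝ m v y‖ ^ q)
  set I := ∫ y in F '' K, ‖iteratedFDeriv ℝ m v y‖ ^ q with hI
  have hI0 : 0 ≤ I := integral_nonneg fun _ => Real.rpow_nonneg (norm_nonneg _) _
  have hSI : S = I ^ (1 / q) := rfl
  have hS0 : 0 ≤ S := by rw [hSI]; positivity
  -- boundedness of the m-th derivative
  obtain ⟨B, hB0, hB⟩ : ∃ B : ℝ, 0 ≤ B ∧ ∀ x ∈ K, ‖iteratedFDeriv ℝ m v (F x)‖ ≤ B := by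
    refine ⟨2 ^ m * (C1 * h⁻¹ ^ m * M / c₁ ^ n), by positivity, fun x hx => ?_⟩
    exact iteratedFDeriv_le hΩ hv m _ (by positivity) (mem_image_of_mem F hx)
      fun l hl c => PRep.le D hc₁ (R1 c l hl) hx
  have hIntg : IntegrableOn (fun x => (h ^ 2 * ev (Jt h P1 P2) x) *
      ‖iteratedFDeriv ℝ m v (F x)‖ ^ q) K := by
    refine IntegrableOn.of_bound hb.measure_lt_top ?_ ((h ^ 2 * c₂) * B ^ q) ?_
    · refine ContinuousOn.aestronglyMeasurable ?_ hK.measurableSet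
      have c1 : ContinuousOn (fun y => iteratedFDeriv ℝ m v y) (F '' K) := by
        intro y hy
        exact ((hv.contDiffAt (hΩ.mem_nhds hy)).continuousAt_iteratedFDeriv
          (by exact_mod_cast le_top)).continuousWithinAt
      have c2 : ContinuousOn (fun x => iteratedFDeriv ℝ m v (F x)) K :=
        c1.comp D.contDiff.continuous.continuousOn (mapsTo_image F K)
      exact (continuous_const.mul (ev_continuous _)).continuousOn.mul
        (c2.norm.rpow_const fun x _ => Or.inr hq0.le)
    · refine (ae_restrict_iff' hK.measurableSet).2 (Filter.Eventually.of_forall fun x hx => ?_)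
      have j1 : 0 < ev (Jt h P1 P2) x := hc₁.trans_le (D.J1 x hx)
      have j2 := D.J2 x hx
      have j3 := hB x hx
      rw [Real.norm_of_nonneg (by positivity)]
      gcongr
  -- improved bound of the polynomials
  have R2 : ∀ c, ∀ l : List (Fin 2), l.length = m →
      PRep K (Jt h P1 P2) F (dirD l (fun z => prj c (v z))) n d
        (C3 * (c₂ ^ n * (c₁⁻¹ ^ (1 / q) * (h ^ 2)⁻¹ ^ (1 / q)) * S)) := by
    intro c l hl
    obtain ⟨P, hPd, -, hPw⟩ := R1 c l hl
    refine ⟨P, hPd, fun x hx => ?_, hPw⟩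
    refine ((H3 P hPd x hx).1).trans ?_
    refine mul_le_mul_of_nonneg_left ?_ hC3.le
    have hle : ∫ y in K, |ev P y| ^ q ≤ ((c₂ ^ n) ^ q * (c₁⁻¹ * (h ^ 2)⁻¹)) * I := by
      rw [hcov, ← integral_const_mul]
      refine integral_mono_of_nonneg (Filter.Eventually.of_forall fun y => by
        simp only [Pi.zero_apply]; positivity) (hIntg.const_mul _) ?_
      refine (ae_restrict_iff' hK.measurableSet).2 (Filter.Eventually.of_forall fun x hx => ?_)
      have j1 := D.J1 x hx
      have j0 : 0 < ev (Jt h P1 P2) x := hc₁.trans_le j1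
      have j2 := D.J2 x hx
      have j3 := dirD_le_norm hΩ hv (mem_image_of_mem F hx) l c
      rw [hl] at j3
      simp only
      rw [← hPw x hx, abs_mul, abs_pow, abs_of_pos j0]
      calc _ ≤ (‖iteratedFDeriv ℝ m v (F x)‖ * c₂ ^ n) ^ q := by gcongr
        _ = (c₂ ^ n) ^ q * 1 * ‖iteratedFDeriv ℝ m v (F x)‖ ^ q := by
            rw [Real.mul_rpow (norm_nonneg _) (by positivity)]; ring
        _ ≤ (c₂ ^ n) ^ q * (c₁⁻¹ * ev (Jt h P1 P2) x) * ‖iteratedFDeriv ℝ m v (F x)‖ ^ q := by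
            have : 1 ≤ c₁⁻¹ * ev (Jt h P1 P2) x := by
              rw [← div_eq_inv_mul, one_le_div hc₁]; exact j1
            gcongr
        _ = _ := by field_simp
    calc _ ≤ (((c₂ ^ n) ^ q * (c₁⁻¹ * (h ^ 2)⁻¹)) * I) ^ (1 / q) := by
          refine Real.rpow_le_rpow (integral_nonneg fun _ => by positivity) hle (by positivity)
      _ = _ := by
          rw [Real.mul_rpow (by positivity) hI0, Real.mul_rpow (by positivity) (by positivity),
            Real.mul_rpow (by positivity) (by positivity), ← Real.rpow_mul (by positivity),
            mul_one_div_cancel hq0.ne', Real.rpow_one, hSI]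
  rintro _ ⟨x, hx, rfl⟩
  have hfin := iteratedFDeriv_le hΩ hv (m + r)
    (C2 * h⁻¹ ^ r * (C3 * (c₂ ^ n * (c₁⁻¹ ^ (1 / q) * (h ^ 2)⁻¹ ^ (1 / q)) * S)) / c₁ ^ (n + 2 * r))
    (by positivity) (mem_image_of_mem F hx) (fun l hl c => by
      have hdr : (l.drop r).length = m := by rw [List.length_drop]; omega
      have htk : (l.take r).length = r := by rw [List.length_take]; omega
      have := H2 h F P1 P2 D hΩ _ _ (by positivity) (dirD_contDiffOn hΩ (hvc c) (l.drop r))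
        (R2 c (l.drop r) hdr) (l.take r) htk
      rw [← dirD_append, List.take_append_drop] at this
      exact PRep.le D hc₁ this hx)
  refine hfin.trans (le_of_eq ?_)
  ring

open scoped ContDiff in
lemma key2 {K : Set (ℝ × ℝ)} (hK : IsOpen K) (hne : K.Nonempty)
    (hb : Bornology.IsBounded K) (k : ℕ) {CF c₁ c₂ : ℝ} (hCF : 0 < CF)
    (hc₁ : 0 < c₁) (hc₂ : 0 < c₂) (p q : ℝ) (hp : 1 ≤ p) (hq : 1 ≤ q) (m r : ℕ) :
    ∃ C : ℝ, 0 < C ∧ ∀ (h : ℝ) (F : ℝ × ℝ → ℝ × ℝ) (P1 P2 : MvPolynomial (Fin 2) ℝ),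
    Dat K k CF c₁ c₂ h F P1 P2 → ∀ v : ℝ × ℝ → ℝ × ℝ, ContDiffOn ℝ ∞ v (F '' K) →
    ∀ M : ℝ, 0 ≤ M → (∀ c, PRep K (Jt h P1 P2) F (fun z => prj c (v z)) 1 (2 * k) M) →
    semiLp (m + r) p v (F '' K) ≤
      C * (h⁻¹ ^ r * h ^ (2 * (1 / p - 1 / q))) * semiLp m q v (F '' K) := by
  have hp0 : 0 < p := by linarith
  obtain ⟨C, hC, H⟩ := key hK hne hb k hCF hc₁ hc₂ q hq m r
  refine ⟨C * (c₂ * (volume.real K + 1)) ^ (1 / p), by positivity, ?_⟩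
  intro h F P1 P2 D v hv M hM hR
  have h0 := D.h0
  have H' := H h F P1 P2 D v hv M hM hR
  set S := semiLp m q v (F '' K)
  have hS0 : 0 ≤ S := Real.rpow_nonneg (integral_nonneg fun _ => Real.rpow_nonneg (norm_nonneg _) _) _
  set B := C * (h⁻¹ ^ r * ((h ^ 2)⁻¹) ^ (1 / q)) * S with hBdef
  have hB0 : 0 ≤ B := by positivity
  have hle : ∫ y in F '' K, ‖iteratedFDeriv ℝ (m + r) v y‖ ^ p ≤
      B ^ p * (h ^ 2 * (c₂ * (volume.real K + 1))) := by
    rw [D.cov hK hc₁]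
    refine (Real.le_norm_self _).trans ((norm_setIntegral_le_of_norm_le_const
      (C := (h ^ 2 * c₂) * B ^ p) hb.measure_lt_top ?_).trans ?_)
    · intro x hx
      have j1 : 0 < ev (Jt h P1 P2) x := hc₁.trans_le (D.J1 x hx)
      have j2 := D.J2 x hx
      have j3 := H' _ (mem_image_of_mem F hx)
      rw [Real.norm_of_nonneg (by positivity)]
      gcongr
    · have : 0 ≤ (h ^ 2 * c₂) * B ^ p := by positivity
      nlinarith
  calc semiLp (m + r) p v (F '' K) ≤ (B ^ p * (h ^ 2 * (c₂ * (volume.real K + 1)))) ^ (1 / p) :=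
        Real.rpow_le_rpow (integral_nonneg fun _ => Real.rpow_nonneg (norm_nonneg _) _) hle
          (by positivity)
    _ = B * ((h ^ 2) ^ (1 / p) * (c₂ * (volume.real K + 1)) ^ (1 / p)) := by
        rw [Real.mul_rpow (by positivity) (by positivity), ← Real.rpow_mul hB0,
          mul_one_div_cancel hp0.ne', Real.rpow_one, Real.mul_rpow (by positivity) (by positivity)]
    _ = _ := by
        have e : h ^ (2 * (1 / p - 1 / q)) = (h ^ 2)⁻¹ ^ (1 / q) * (h ^ 2) ^ (1 / p) := by
          rw [Real.inv_rpow (by positivity), ← Real.rpow_natCast h 2, ← Real.rpow_mul h0.le,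
            ← Real.rpow_mul h0.le, ← Real.rpow_neg h0.le, ← Real.rpow_add h0]
          congr 1; push_cast; ring
        rw [e, hBdef]; ring
lemma hull_subset (i : Fin 3) : convexHull ℝ {vtx i, vtx (i + 1), ((1 : ℝ) / 3, (1 : ℝ) / 3)} ⊆
    {x : ℝ × ℝ | 0 ≤ x.1 ∧ 0 ≤ x.2 ∧ x.1 + x.2 ≤ 1} := by
  refine convexHull_min ?_ ?_
  · intro x hx
    simp only [mem_insert_iff, mem_singleton_iff] at hx
    rcases hx with rfl | rfl | rfl
    · fin_cases i <;> simp [vtx]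
    · fin_cases i <;> simp [vtx]
    · norm_num
  · intro x hx y hy a b ha hb hab
    obtain ⟨h1, h2, h3⟩ := hx
    obtain ⟨h4, h5, h6⟩ := hy
    simp only [mem_setOf_eq, Prod.fst_add, Prod.snd_add, Prod.smul_fst, Prod.smul_snd, smul_eq_mul]
    refine ⟨by positivity, by positivity, ?_⟩
    nlinarith [mul_le_mul_of_nonneg_left h3 ha, mul_le_mul_of_nonneg_left h6 hb]

lemma ctK_subset (i : Fin 3) : ctK i ⊆ Tref := by
  intro x hx
  have hx' : ∀ᶠ y in nhds x, y ∈ {x : ℝ × ℝ | 0 ≤ x.1 ∧ 0 ≤ x.2 ∧ x.1 + x.2 ≤ 1} :=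
    Filter.mem_of_superset (mem_interior_iff_mem_nhds.1 hx) (hull_subset i)
  obtain ⟨ε, hε, hball⟩ := Metric.eventually_nhds_iff.1 hx'
  have a1 := @hball (x.1 - ε / 2, x.2) (by
    rw [Prod.dist_eq]; simp [Real.dist_eq, abs_of_pos hε]; linarith)
  have a2 := @hball (x.1, x.2 - ε / 2) (by
    rw [Prod.dist_eq]; simp [Real.dist_eq, abs_of_pos hε]; linarith)
  have a3 := @hball (x.1 + ε / 2, x.2) (by
    rw [Prod.dist_eq]; simp [Real.dist_eq, abs_of_pos hε]; linarith)
  simp only [mem_setOf_eq] at a1 a2 a3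
  refine ⟨?_, ?_, ?_⟩ <;> linarith

lemma ctK_bounded (i : Fin 3) : Bornology.IsBounded (ctK i) := by
  refine Bornology.IsBounded.subset ?_ interior_subset
  rw [isBounded_convexHull]
  exact (Set.toFinite _).isBounded

lemma mem_hull3 (a b c x : ℝ × ℝ) (r s t : ℝ) (hr : 0 ≤ r) (hs : 0 ≤ s) (ht : 0 ≤ t)
    (h : r + s + t = 1) (hx : x = r • a + s • b + t • c) : x ∈ convexHull ℝ {a, b, c} := by
  have hc := convex_convexHull ℝ ({a, b, c} : Set (ℝ × ℝ))
  have ha : a ∈ convexHull ℝ ({a, b, c} : Set (ℝ × ℝ)) := subset_convexHull ℝ _ (by simp)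
  have hb : b ∈ convexHull ℝ ({a, b, c} : Set (ℝ × ℝ)) := subset_convexHull ℝ _ (by simp)
  have hcc : c ∈ convexHull ℝ ({a, b, c} : Set (ℝ × ℝ)) := subset_convexHull ℝ _ (by simp)
  have := hc.sum_mem (t := Finset.univ) (w := ![r, s, t]) (z := ![a, b, c])
    (by intro i _; fin_cases i <;> simpa) (by simp [Fin.sum_univ_three, h])
    (by intro i _; fin_cases i <;> simpa)
  rw [hx]
  simpa [Fin.sum_univ_three] using this

lemma ctK_nonempty (i : Fin 3) : (ctK i).Nonempty := by
  have hopen : ∀ f : ℝ × ℝ → ℝ, Continuous f → IsOpen {x | 0 < f x} :=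
    fun f hf => isOpen_lt continuous_const hf
  fin_cases i
  · refine ⟨(1 / 2, 1 / 8), ?_⟩
    refine mem_interior.2 ⟨{x | 0 < x.2} ∩ {x | 0 < x.1 - x.2} ∩ {x | 0 < 1 - x.1 - 2 * x.2}, ?_,
      ((hopen _ (by fun_prop)).inter (hopen _ (by fun_prop))).inter (hopen _ (by fun_prop)), ?_⟩
    · rintro x ⟨⟨h1, h2⟩, h3⟩
      simp only [mem_setOf_eq] at h1 h2 h3
      refine mem_hull3 _ _ _ _ (1 - x.1 - 2 * x.2) (x.1 - x.2) (3 * x.2) h3.le h2.le (by linarith)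
        (by ring) ?_
      ext <;> simp [vtx] <;> ring
    · norm_num
  · refine ⟨(4 / 9, 4 / 9), ?_⟩
    refine mem_interior.2 ⟨{x | 0 < 1 - x.1 - x.2} ∩ {x | 0 < 2 * x.1 + x.2 - 1} ∩
      {x | 0 < x.1 + 2 * x.2 - 1}, ?_,
      ((hopen _ (by fun_prop)).inter (hopen _ (by fun_prop))).inter (hopen _ (by fun_prop)), ?_⟩
    · rintro x ⟨⟨h1, h2⟩, h3⟩
      simp only [mem_setOf_eq] at h1 h2 h3
      refine mem_hull3 _ _ _ _ (2 * x.1 + x.2 - 1) (x.1 + 2 * x.2 - 1) (3 * (1 - x.1 - x.2))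
        h2.le h3.le (by linarith) (by ring) ?_
      ext <;> simp [vtx] <;> ring
    · norm_num
  · refine ⟨(1 / 8, 1 / 2), ?_⟩
    refine mem_interior.2 ⟨{x | 0 < x.1} ∩ {x | 0 < x.2 - x.1} ∩ {x | 0 < 1 - x.2 - 2 * x.1}, ?_,
      ((hopen _ (by fun_prop)).inter (hopen _ (by fun_prop))).inter (hopen _ (by fun_prop)), ?_⟩
    · rintro x ⟨⟨h1, h2⟩, h3⟩
      simp only [mem_setOf_eq] at h1 h2 h3
      refine mem_hull3 _ _ _ _ (x.2 - x.1) (1 - x.2 - 2 * x.1) (3 * x.1) h2.le h3.le (by linarith)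
        (by ring) ?_
      ext <;> simp [vtx] <;> ring
    · norm_num

lemma mkDat {k : ℕ} (hk : 2 ≤ k) {CF c₁ c₂ h : ℝ} (h0 : 0 < h) (h1 : h ≤ 1)
    {F : ℝ × ℝ → ℝ × ℝ} {P1 P2 : MvPolynomial (Fin 2) ℝ} (d1 : P1.totalDegree ≤ k)
    (d2 : P2.totalDegree ≤ k) (hF : F = fun x => (ev P1 x, ev P2 x))
    (hI : IsoparamBounds k CF c₁ c₂ h F) {K : Set (ℝ × ℝ)} (hK : K ⊆ Tref) :
    Dat K k CF c₁ c₂ h F P1 P2 := by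
  obtain ⟨hinj, hD, -, hJ⟩ := hI
  have hder : ∀ x, HasFDerivAt F (DP P1 P2 x) x := by
    intro x
    rw [hF]
    exact (ev_hasFDerivAt P1 x).prodMk (ev_hasFDerivAt P2 x)
  have hjac : ∀ x, jacDet F x = h ^ 2 * ev (Jt h P1 P2) x := by
    intro x
    rw [jacDet, (hder x).fderiv, det_DP h0]
  have hn : ∀ x ∈ K, ‖DP P1 P2 x‖ ≤ CF * h := by
    intro x hx
    have := hD 1 (by omega) x (hK hx)
    rwa [norm_iteratedFDeriv_one, (hder x).fderiv, pow_one] at this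
  have hb : ∀ x ∈ K, ∀ a, ‖DP P1 P2 x (dirv a)‖ ≤ CF * h := by
    intro x hx a
    refine ((DP P1 P2 x).le_opNorm _).trans ((mul_le_of_le_one_right (norm_nonneg _)
      (norm_dirv a)).trans (hn x hx))
  have hh : 0 < h ^ 2 := by positivity
  refine ⟨h0, h1, d1, d2, hF, ?_, ?_, ?_, ?_, hinj.mono (hK.trans subset_closure)⟩
  · intro x hx a
    have := (norm_fst_le _).trans (hb x hx a)
    rw [DP_apply] at this
    fin_cases a <;> simpa [dirv] using this
  · intro x hx a
    have := (norm_snd_le _).trans (hb x hx a)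
    rw [DP_apply] at this
    fin_cases a <;> simpa [dirv] using this
  · intro x hx
    have := (hJ x (subset_closure (hK hx))).1
    rw [hjac] at this
    nlinarith
  · intro x hx
    have := (hJ x (subset_closure (hK hx))).2
    rw [hjac] at this
    nlinarith

open scoped ContDiff in
lemma piola_rep {k : ℕ} {CF c₁ c₂ h : ℝ} (hc₁ : 0 < c₁)
    {F : ℝ × ℝ → ℝ × ℝ} {P1 P2 : MvPolynomial (Fin 2) ℝ} {K : Set (ℝ × ℝ)} (hK : IsOpen K)
    (hne : K.Nonempty) (hb : Bornology.IsBounded K)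
    (hKT : K ⊆ Tref) (D : Dat K k CF c₁ c₂ h F P1 P2) {vhat v : ℝ × ℝ → ℝ × ℝ}
    (hvh : IsPolyMap k vhat) (hv : IsPiola F vhat v) :
    ContDiffOn ℝ ∞ v (F '' K) ∧ ∃ M : ℝ, 0 ≤ M ∧
      ∀ c, PRep K (Jt h P1 P2) F (fun z => prj c (v z)) 1 (2 * k) M := by
  obtain ⟨V1, V2, hV1, hV2, hV⟩ := hvh
  have h0 := D.h0
  let N : MvPolynomial (Fin 2) ℝ → MvPolynomial (Fin 2) ℝ := fun P =>
    MvPolynomial.C (h ^ 2)⁻¹ * (MvPolynomial.pderiv 0 P * V1 + MvPolynomial.pderiv 1 P * V2)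
  have hNd : ∀ P : MvPolynomial (Fin 2) ℝ, P.totalDegree ≤ k → (N P).totalDegree ≤ 2 * k :=
    fun P hP => td_Cmul _ (td_add (td_mul (td_pd hP 0) hV1 (by omega))
      (td_mul (td_pd hP 1) hV2 (by omega)))
  have hG : ∀ x ∈ K, v (F x) = ((ev (Jt h P1 P2) x)⁻¹ * ev (N P1) x,
      (ev (Jt h P1 P2) x)⁻¹ * ev (N P2) x) := by
    intro x hx
    have hJ : 0 < ev (Jt h P1 P2) x := hc₁.trans_le (D.J1 x hx)
    have hvx : vhat x = (ev V1 x, ev V2 x) := hV x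
    rw [hv x (subset_closure (hKT hx)), Amap, jacDet, (D.hasFDerivAt x).fderiv, det_DP h0, hvx]
    simp only [smul_apply, DP_apply, N, ev_mul, ev_add, ev_C, Prod.smul_mk, smul_eq_mul]
    ext <;> simp only [mul_inv] <;> ring
  refine ⟨D.contDiffOn hK hc₁ v _ ?_ hG, ?_⟩
  · intro x hx
    have hJ : 0 < ev (Jt h P1 P2) x := hc₁.trans_le (D.J1 x hx)
    have hi : ContDiffAt ℝ ∞ (fun x => (ev (Jt h P1 P2) x)⁻¹) x :=
      (ev_contDiff _).contDiffAt.inv hJ.ne'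
    exact (hi.mul (ev_contDiff _).contDiffAt).prodMk (hi.mul (ev_contDiff _).contDiffAt)
  · obtain ⟨C, hC, H⟩ := polyBound hK hne hb 1 le_rfl (2 * k)
    let I : MvPolynomial (Fin 2) ℝ → ℝ := fun P => C * (∫ y in K, |ev P y| ^ (1 : ℝ)) ^ (1 / (1 : ℝ))
    have hI0 : ∀ P, 0 ≤ I P := fun P => mul_nonneg hC.le (Real.rpow_nonneg (integral_nonneg fun _ =>
      Real.rpow_nonneg (abs_nonneg _) _) _)
    refine ⟨I (N P1) + I (N P2), add_nonneg (hI0 _) (hI0 _), fun c => ?_⟩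
    fin_cases c
    · refine ⟨N P1, hNd _ D.d1, fun x hx => ?_, fun x hx => ?_⟩
      · exact ((H _ (hNd _ D.d1) x hx).1).trans (le_add_of_nonneg_right (hI0 _))
      · have hJ : 0 < ev (Jt h P1 P2) x := hc₁.trans_le (D.J1 x hx)
        simp only [hG x hx, prj]
        simp
        field_simp
    · refine ⟨N P2, hNd _ D.d2, fun x hx => ?_, fun x hx => ?_⟩
      · exact ((H _ (hNd _ D.d2) x hx).1).trans (le_add_of_nonneg_left (hI0 _))
      · have hJ : 0 < ev (Jt h P1 P2) x := hc₁.trans_le (D.J1 x hx)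
        simp only [hG x hx, prj]
        simp
        field_simp

/-- Inverse estimate for Piola-transformed piecewise polynomials:
`‖v‖_{W^{ℓ,p}(F(K̂ᵢ))} ≤ C h^{m−ℓ+2(1/p−1/q)} ‖v‖_{W^{m,q}(F(K̂ᵢ))}`. -/
theorem stmt4 (k ℓ m : ℕ) (hk : 2 ≤ k) (hmℓ : m ≤ ℓ) (p q : ℝ) (hp : 1 ≤ p) (hq : 1 ≤ q)
    (CF c₁ c₂ : ℝ) (hCF : 0 < CF) (hc₁ : 0 < c₁) (hc₂ : 0 < c₂) :
    ∃ C : ℝ, 0 < C ∧ ∀ h : ℝ, h ∈ Set.Ioc (0 : ℝ) 1 → ∀ F : ℝ × ℝ → ℝ × ℝ,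
      IsPolyMap k F → IsoparamBounds k CF c₁ c₂ h F →
      ∀ vhat : ℝ × ℝ → ℝ × ℝ, IsPolyMap k vhat →
      ∀ v : ℝ × ℝ → ℝ × ℝ, IsPiola F vhat v →
      ∀ i : Fin 3,
        normWmp ℓ p v (F '' ctK i) ≤
          C * h ^ ((m : ℝ) - (ℓ : ℝ) + 2 * (1 / p - 1 / q)) * normWmp m q v (F '' ctK i) := by
  have hex : ∀ (i : Fin 3) (j : ℕ), ∃ C : ℝ, 0 < C ∧
      ∀ (h : ℝ) (F : ℝ × ℝ → ℝ × ℝ) (P1 P2 : MvPolynomial (Fin 2) ℝ),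
      Dat (ctK i) k CF c₁ c₂ h F P1 P2 → ∀ v : ℝ × ℝ → ℝ × ℝ,
      ContDiffOn ℝ ((⊤ : ℕ∞) : WithTop ℕ∞) v (F '' ctK i) →
      ∀ M : ℝ, 0 ≤ M → (∀ c, PRep (ctK i) (Jt h P1 P2) F (fun z => prj c (v z)) 1 (2 * k) M) →
      semiLp (min j m + (j - m)) p v (F '' ctK i) ≤
        C * (h⁻¹ ^ (j - m) * h ^ (2 * (1 / p - 1 / q))) * semiLp (min j m) q v (F '' ctK i) :=
    fun i j => key2 isOpen_interior (ctK_nonempty i) (ctK_bounded i) k hCF hc₁ hc₂ p q hp hq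
      (min j m) (j - m)
  choose C hC H using hex
  refine ⟨∑ i, ∑ j ∈ Finset.range (ℓ + 1), C i j, ?_, ?_⟩
  · exact Finset.sum_pos (fun i _ => Finset.sum_pos (fun j _ => hC i j) (by simp)) (by simp)
  rintro h ⟨h0, h1⟩ F ⟨P1, P2, d1, d2, hF⟩ hI vhat hvh v hv i
  have hF' : F = fun x => (ev P1 x, ev P2 x) := funext hF
  have D := mkDat hk h0 h1 d1 d2 hF' hI (ctK_subset i)
  obtain ⟨hcd, M, hM, hR⟩ := piola_rep hc₁ isOpen_interior (ctK_nonempty i) (ctK_bounded i)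
    (ctK_subset i) D hvh hv
  have hs0 : ∀ j (p : ℝ), 0 ≤ semiLp j p v (F '' ctK i) := fun j p =>
    Real.rpow_nonneg (integral_nonneg fun _ => Real.rpow_nonneg (norm_nonneg _) _) _
  have hN0 : 0 ≤ normWmp m q v (F '' ctK i) := Finset.sum_nonneg fun j _ => hs0 j q
  set E := h ^ ((m : ℝ) - (ℓ : ℝ) + 2 * (1 / p - 1 / q)) with hE
  have hE0 : 0 < E := Real.rpow_pos_of_pos h0 _
  have hterm : ∀ j ∈ Finset.range (ℓ + 1), semiLp j p v (F '' ctK i) ≤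
      C i j * (E * normWmp m q v (F '' ctK i)) := by
    intro j hj
    have hjℓ : j ≤ ℓ := by simpa [Nat.lt_succ_iff] using hj
    have hj' : min j m + (j - m) = j := by omega
    have hh := H i j h F P1 P2 D v hcd M hM hR
    rw [hj'] at hh
    have e1 : h⁻¹ ^ (j - m) * h ^ (2 * (1 / p - 1 / q)) ≤ E := by
      have : h⁻¹ ^ (j - m) = h ^ (-((j - m : ℕ) : ℝ)) := by
        rw [Real.rpow_neg h0.le, Real.rpow_natCast, inv_pow]
      rw [this, ← Real.rpow_add h0]
      refine Real.rpow_le_rpow_of_exponent_ge h0 h1 ?_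
      have e2 : ((j - m : ℕ) : ℝ) ≤ (ℓ : ℝ) - m := by
        rw [← Nat.cast_sub hmℓ]
        exact_mod_cast Nat.sub_le_sub_right hjℓ m
      linarith
    have e3 : semiLp (min j m) q v (F '' ctK i) ≤ normWmp m q v (F '' ctK i) :=
      Finset.single_le_sum (f := fun j => semiLp j q v (F '' ctK i)) (fun j _ => hs0 j q)
        (by simp [Nat.lt_succ_iff])
    calc _ ≤ _ := hh
      _ ≤ C i j * E * normWmp m q v (F '' ctK i) :=
        mul_le_mul (mul_le_mul_of_nonneg_left e1 (hC i j).le) e3 (hs0 _ _)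
          (mul_nonneg (hC i j).le hE0.le)
      _ = _ := by ring
  calc normWmp ℓ p v (F '' ctK i)
      ≤ ∑ j ∈ Finset.range (ℓ + 1), C i j * (E * normWmp m q v (F '' ctK i)) :=
        Finset.sum_le_sum hterm
    _ = (∑ j ∈ Finset.range (ℓ + 1), C i j) * (E * normWmp m q v (F '' ctK i)) := by
        rw [Finset.sum_mul]
    _ ≤ (∑ i, ∑ j ∈ Finset.range (ℓ + 1), C i j) * (E * normWmp m q v (F '' ctK i)) := by
        refine mul_le_mul_of_nonneg_right ?_ (mul_nonneg hE0.le hN0)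
        exact Finset.single_le_sum (f := fun i => ∑ j ∈ Finset.range (ℓ + 1), C i j)
          (fun i _ => Finset.sum_nonneg fun j _ => (hC i j).le) (Finset.mem_univ i)
    _ = _ := by ring
end
end

section
/- Let k ≥ 1 be an integer. The real vector space of continuous functions u from the closed reference triangle (closure of T̂) to ℝ such that, for each i ∈ {1,2,3}, the restriction of u to the closed subtriangle K̂ᵢ agrees with a polynomial in two variables of total degree ≤ k, has dimension (3/2)k(k+1) + 1. -/
open Set MeasureTheory Function

noncomputable section

/-- The set of continuous functions on the closed reference triangle that are piecewise
polynomial of degree ≤ k on the Clough–Tocher split. -/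
def ctSplineSet (k : ℕ) : Set (↥(closure Tref) → ℝ) :=
  {u | Continuous u ∧ ∀ i : Fin 3, ∃ p : MvPolynomial (Fin 2) ℝ, p.totalDegree ≤ k ∧
    ∀ x : ↥(closure Tref), (x : ℝ × ℝ) ∈ closure (ctK i) →
      u x = MvPolynomial.eval ![(x : ℝ × ℝ).1, (x : ℝ × ℝ).2] p}

open MvPolynomial in
/-- Polynomials in two variables of total degree `< n`. -/
def ctPD (n : ℕ) : Submodule ℝ (MvPolynomial (Fin 2) ℝ) :=
  MvPolynomial.restrictSupport ℝ {s : Fin 2 →₀ ℕ | s 0 + s 1 < n}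

lemma ct_sum_eq (s : Fin 2 →₀ ℕ) : (s.sum fun _ e => e) = s 0 + s 1 := by
  rw [Finsupp.sum_fintype _ _ (by simp)]
  simp [Fin.sum_univ_two]

lemma mem_ctPD (n : ℕ) (p : MvPolynomial (Fin 2) ℝ) :
    p ∈ ctPD n ↔ ∀ s ∈ p.support, s 0 + s 1 < n := by
  unfold ctPD
  rw [MvPolynomial.mem_restrictSupport_iff]
  rfl

lemma mem_ctPD_succ (n : ℕ) (p : MvPolynomial (Fin 2) ℝ) :
    p ∈ ctPD (n + 1) ↔ p.totalDegree ≤ n := by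
  rw [mem_ctPD]
  unfold MvPolynomial.totalDegree
  rw [Finset.sup_le_iff]
  simp only [ct_sum_eq, Nat.lt_succ_iff]

lemma ctPD_zero {p : MvPolynomial (Fin 2) ℝ} (hp : p ∈ ctPD 0) : p = 0 := by
  rw [mem_ctPD] at hp
  rw [← MvPolynomial.support_eq_empty, Finset.eq_empty_iff_forall_notMem]
  intro s hs
  exact absurd (hp s hs) (by simp)

/-- The index finset of monomials of degree `< n`. -/
def ctIdx (n : ℕ) : Finset (ℕ × ℕ) := (Finset.range n).biUnion (fun i => Finset.HasAntidiagonal.antidiagonal i)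

lemma mem_ctIdx (n : ℕ) (a : ℕ × ℕ) : a ∈ ctIdx n ↔ a.1 + a.2 < n := by
  simp [ctIdx]

lemma card_ctIdx (n : ℕ) : (ctIdx n).card * 2 = n * (n + 1) := by
  unfold ctIdx
  rw [Finset.card_biUnion]
  · simp only [Finset.Nat.card_antidiagonal]
    have := Finset.sum_range_id_mul_two (n + 1)
    rw [Finset.sum_range_succ'] at this
    simp only [add_zero] at this
    rw [this]
    simp [mul_comm]
  · intro i _ j _ hij
    rw [Function.onFun, Finset.disjoint_left]
    intro a ha hb
    rw [Finset.HasAntidiagonal.mem_antidiagonal] at ha hb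
    omega

/-- Exponents of degree `< n` as pairs. -/
def ctIdxEquiv (n : ℕ) : {s : Fin 2 →₀ ℕ | s 0 + s 1 < n} ≃ ctIdx n :=
  ((Finsupp.equivFunOnFinite (α := Fin 2) (M := ℕ)).trans (finTwoArrowEquiv ℕ)).subtypeEquiv
    (by intro s; rw [mem_ctIdx]; simp [finTwoArrowEquiv])

/-- A basis of `ctPD n`. -/
def ctBasis (n : ℕ) : Module.Basis (ctIdx n) ℝ (ctPD n) :=
  (MvPolynomial.basisRestrictSupport ℝ {s : Fin 2 →₀ ℕ | s 0 + s 1 < n}).reindex (ctIdxEquiv n)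

instance (n : ℕ) : Module.Finite ℝ (ctPD n) := Module.Finite.of_basis (ctBasis n)

lemma finrank_ctPD (n : ℕ) : Module.finrank ℝ (ctPD n) * 2 = n * (n + 1) := by
  rw [Module.finrank_eq_card_basis (ctBasis n), Fintype.card_coe, card_ctIdx]

lemma finrank_ct (k : ℕ) (hk : 1 ≤ k) :
    Module.finrank ℝ (ctPD (k + 1) × ctPD k × ctPD (k - 1)) = 3 * k * (k + 1) / 2 + 1 := by
  rw [Module.finrank_prod, Module.finrank_prod]
  obtain ⟨m, rfl⟩ : ∃ m, k = m + 1 := ⟨k - 1, by omega⟩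
  have h1 := finrank_ctPD (m + 1 + 1)
  have h2 := finrank_ctPD (m + 1)
  have h3 := finrank_ctPD m
  change _ + (_ + Module.finrank ℝ (ctPD m)) = _
  have : 3 * (m + 1) * (m + 1 + 1) = 2 * (Module.finrank ℝ (ctPD (m + 1)) * 3) := by
    linarith
  rw [this, Nat.mul_div_cancel_left _ (by norm_num)]
  nlinarith

/-- The linear form `X - (α + β Y)`. -/
def ctL (α β : ℝ) : MvPolynomial (Fin 2) ℝ :=
  MvPolynomial.X 0 - (MvPolynomial.C α + MvPolynomial.C β * MvPolynomial.X 1)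

lemma eval_ctL (α β x y : ℝ) : MvPolynomial.eval ![x, y] (ctL α β) = x - (α + β * y) := by
  simp [ctL]

lemma ctL_ne_zero (α β : ℝ) : ctL α β ≠ 0 := by
  intro h
  have := eval_ctL α β (α + 1) 0
  rw [h] at this
  simp at this

lemma ctL_totalDegree_le (α β : ℝ) : (ctL α β).totalDegree ≤ 1 := by
  unfold ctL
  refine (MvPolynomial.totalDegree_sub _ _).trans (max_le (by simp) ?_)
  refine (MvPolynomial.totalDegree_add _ _).trans (max_le (by simp) ?_)
  refine (MvPolynomial.totalDegree_mul _ _).trans (by simp)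

lemma ctL_totalDegree (α β : ℝ) : 1 ≤ (ctL α β).totalDegree := by
  by_contra h
  have h0 : (ctL α β).totalDegree = 0 := by omega
  rw [MvPolynomial.totalDegree_eq_zero_iff_eq_C] at h0
  have h1 := eval_ctL α β (α + 1) 0
  have h2 := eval_ctL α β α 0
  rw [h0] at h1 h2
  simp only [MvPolynomial.eval_C] at h1 h2
  linarith

lemma ctL_mul_mem {α β : ℝ} {n : ℕ} {q : MvPolynomial (Fin 2) ℝ} :
    ctL α β * q ∈ ctPD (n + 1) ↔ q ∈ ctPD n := by
  by_cases hq : q = 0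
  · subst hq; simp
  rw [mem_ctPD_succ, MvPolynomial.totalDegree_mul_of_isDomain (ctL_ne_zero α β) hq]
  have h1 := ctL_totalDegree α β
  have h2 := ctL_totalDegree_le α β
  cases n with
  | zero =>
    constructor
    · intro h; omega
    · intro h; exact absurd (ctPD_zero h) hq
  | succ n => rw [mem_ctPD_succ]; omega

lemma ctL_dvd {α β : ℝ} {p : MvPolynomial (Fin 2) ℝ} {S : Set ℝ} (hS : S.Infinite)
    (h : ∀ t ∈ S, MvPolynomial.eval ![α + β * t, t] p = 0) : ctL α β ∣ p := by
  set f : MvPolynomial (Fin 2) ℝ →ₐ[ℝ] Polynomial ℝ :=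
    MvPolynomial.aeval ![Polynomial.C α + Polynomial.C β * Polynomial.X, Polynomial.X] with hf
  have hev : ∀ t : ℝ, (f p).eval t = MvPolynomial.eval ![α + β * t, t] p := by
    intro t
    have : ((Polynomial.aeval t).comp f : MvPolynomial (Fin 2) ℝ →ₐ[ℝ] ℝ)
        = MvPolynomial.aeval ![α + β * t, t] := by
      apply MvPolynomial.algHom_ext
      intro i
      fin_cases i <;> simp [hf]
    have := congrArg (fun g => g p) this
    simpa [Polynomial.coe_aeval_eq_eval, MvPolynomial.aeval_eq_eval] using this
  have hfp : f p = 0 := by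
    apply Polynomial.eq_zero_of_infinite_isRoot
    refine hS.mono ?_
    intro t ht
    simp only [Set.mem_ofPred_eq, Polynomial.IsRoot, hev, h t ht]
  set g : Polynomial ℝ →ₐ[ℝ] MvPolynomial (Fin 2) ℝ := Polynomial.aeval (MvPolynomial.X 1) with hg
  rw [← Ideal.mem_span_singleton, ← Ideal.Quotient.eq_zero_iff_mem]
  have key : (Ideal.Quotient.mkₐ ℝ (Ideal.span {ctL α β})) =
      (Ideal.Quotient.mkₐ ℝ (Ideal.span {ctL α β})).comp (g.comp f) := by
    apply MvPolynomial.algHom_ext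
    intro i
    fin_cases i
    · simp only [hf, hg, AlgHom.comp_apply, Ideal.Quotient.mkₐ_eq_mk]
      rw [Ideal.Quotient.eq, Ideal.mem_span_singleton]
      simp [ctL, MvPolynomial.algebraMap_eq]
    · simp [hf, hg]
  have := congrArg (fun g => g p) key
  simpa [hfp] using this

lemma ct_zero_of_box {p : MvPolynomial (Fin 2) ℝ} (a b c d : ℝ) (hab : a < b) (hcd : c < d)
    (h : ∀ x y : ℝ, a < x → x < b → c < y → y < d → MvPolynomial.eval ![x, y] p = 0) :
    p = 0 := by
  refine MvPolynomial.funext_set (![Set.Ioo a b, Set.Ioo c d]) ?_ ?_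
  · intro i
    fin_cases i
    · exact Set.Ioo_infinite hab
    · exact Set.Ioo_infinite hcd
  · intro x hx
    have h0 := hx 0 (Set.mem_univ _)
    have h1 := hx 1 (Set.mem_univ _)
    simp only [Matrix.cons_val_zero, Matrix.cons_val_one, Set.mem_Ioo] at h0 h1
    have : x = ![x 0, x 1] := by
      ext i; fin_cases i <;> rfl
    rw [this, h _ _ h0.1 h0.2 h1.1 h1.2, map_zero]

lemma ct_mem_hull (a b c x : ℝ × ℝ) (r s t : ℝ) (hr : 0 ≤ r) (hs : 0 ≤ s) (ht : 0 ≤ t)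
    (h1 : r + s + t = 1) (hx : r • a + s • b + t • c = x) :
    x ∈ convexHull ℝ {a, b, c} := by
  have hc := convex_convexHull ℝ ({a, b, c} : Set (ℝ × ℝ))
  have ha : a ∈ convexHull ℝ ({a, b, c} : Set (ℝ × ℝ)) := subset_convexHull _ _ (by simp)
  have hb : b ∈ convexHull ℝ ({a, b, c} : Set (ℝ × ℝ)) := subset_convexHull _ _ (by simp)
  have hcc : c ∈ convexHull ℝ ({a, b, c} : Set (ℝ × ℝ)) := subset_convexHull _ _ (by simp)
  have := hc.sum_mem (t := Finset.univ) (w := ![r, s, t]) (z := ![a, b, c])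
    (by intro i _; fin_cases i <;> simpa) (by simp [Fin.sum_univ_three, h1])
    (by intro i _; fin_cases i <;> simpa)
  rw [← hx]
  simpa [Fin.sum_univ_three] using this

lemma ct_closure (a b c : ℝ × ℝ) (S U : Set (ℝ × ℝ)) (hS : IsClosed S) (hSc : Convex ℝ S)
    (ha : a ∈ S) (hb : b ∈ S) (hc : c ∈ S) (hsub : S ⊆ convexHull ℝ {a, b, c})
    (hU : IsOpen U) (hUS : U ⊆ S) (hne : U.Nonempty) :
    closure (interior (convexHull ℝ {a, b, c})) = S := by
  have heq : convexHull ℝ {a, b, c} = S := by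
    refine subset_antisymm (convexHull_min ?_ hSc) hsub
    intro x hx
    simp only [Set.mem_insert_iff, Set.mem_singleton_iff] at hx
    rcases hx with rfl | rfl | rfl <;> assumption
  rw [heq, hSc.closure_interior_eq_closure_of_nonempty_interior, hS.closure_eq]
  exact hne.mono (interior_maximal hUS hU)

lemma ct_closed3 {f₁ g₁ f₂ g₂ f₃ g₃ : ℝ × ℝ → ℝ} (a₁ : Continuous f₁) (b₁ : Continuous g₁)
    (a₂ : Continuous f₂) (b₂ : Continuous g₂) (a₃ : Continuous f₃) (b₃ : Continuous g₃) :
    IsClosed {x : ℝ × ℝ | f₁ x ≤ g₁ x ∧ f₂ x ≤ g₂ x ∧ f₃ x ≤ g₃ x} :=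
  (isClosed_le a₁ b₁).inter ((isClosed_le a₂ b₂).inter (isClosed_le a₃ b₃))

lemma ct_open3 {f₁ g₁ f₂ g₂ f₃ g₃ : ℝ × ℝ → ℝ} (a₁ : Continuous f₁) (b₁ : Continuous g₁)
    (a₂ : Continuous f₂) (b₂ : Continuous g₂) (a₃ : Continuous f₃) (b₃ : Continuous g₃) :
    IsOpen {x : ℝ × ℝ | f₁ x < g₁ x ∧ f₂ x < g₂ x ∧ f₃ x < g₃ x} :=
  (isOpen_lt a₁ b₁).inter ((isOpen_lt a₂ b₂).inter (isOpen_lt a₃ b₃))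

lemma closure_ctK0 : closure (ctK 0) =
    {x : ℝ × ℝ | 0 ≤ x.2 ∧ x.2 ≤ x.1 ∧ x.2 ≤ 1 - x.1 - x.2} := by
  have hK : ctK 0 = interior (convexHull ℝ {(0, 0), (1, 0), ((1 : ℝ) / 3, (1 : ℝ) / 3)}) := rfl
  rw [hK]
  apply ct_closure _ _ _ _ {x : ℝ × ℝ | 0 < x.2 ∧ x.2 < x.1 ∧ x.2 < 1 - x.1 - x.2}
  · apply ct_closed3 <;> fun_prop
  · rintro x ⟨h1, h2, h3⟩ y ⟨g1, g2, g3⟩ s t hs ht hst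
    obtain rfl : t = 1 - s := by linarith
    refine ⟨?_, ?_, ?_⟩ <;> simp <;> nlinarith
  · norm_num
  · norm_num
  · norm_num
  · rintro ⟨x, y⟩ ⟨h1, h2, h3⟩
    simp only at h1 h2 h3
    refine ct_mem_hull _ _ _ _ (1 - x - y - y) (x - y) (3 * y) (by linarith) (by linarith)
      (by linarith) (by ring) ?_
    ext <;> simp <;> ring
  · apply ct_open3 <;> fun_prop
  · rintro x ⟨h1, h2, h3⟩
    exact ⟨h1.le, h2.le, h3.le⟩
  · exact ⟨(1/2, 1/10), by norm_num⟩

lemma closure_ctK1 : closure (ctK 1) =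
    {x : ℝ × ℝ | 0 ≤ 1 - x.1 - x.2 ∧ 1 - x.1 - x.2 ≤ x.1 ∧ 1 - x.1 - x.2 ≤ x.2} := by
  have hK : ctK 1 = interior (convexHull ℝ {(1, 0), (0, 1), ((1 : ℝ) / 3, (1 : ℝ) / 3)}) := rfl
  rw [hK]
  apply ct_closure _ _ _ _
    {x : ℝ × ℝ | 0 < 1 - x.1 - x.2 ∧ 1 - x.1 - x.2 < x.1 ∧ 1 - x.1 - x.2 < x.2}
  · apply ct_closed3 <;> fun_prop
  · rintro x ⟨h1, h2, h3⟩ y ⟨g1, g2, g3⟩ s t hs ht hst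
    obtain rfl : t = 1 - s := by linarith
    refine ⟨?_, ?_, ?_⟩ <;> simp <;> nlinarith
  · norm_num
  · norm_num
  · norm_num
  · rintro ⟨x, y⟩ ⟨h1, h2, h3⟩
    simp only at h1 h2 h3
    refine ct_mem_hull _ _ _ _ (x - (1 - x - y)) (y - (1 - x - y)) (3 * (1 - x - y))
      (by linarith) (by linarith) (by linarith) (by ring) ?_
    ext <;> simp <;> ring
  · apply ct_open3 <;> fun_prop
  · rintro x ⟨h1, h2, h3⟩
    exact ⟨h1.le, h2.le, h3.le⟩
  · exact ⟨(9/20, 9/20), by norm_num⟩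

lemma closure_ctK2 : closure (ctK 2) =
    {x : ℝ × ℝ | 0 ≤ x.1 ∧ x.1 ≤ x.2 ∧ x.1 ≤ 1 - x.1 - x.2} := by
  have hK : ctK 2 = interior (convexHull ℝ {(0, 1), (0, 0), ((1 : ℝ) / 3, (1 : ℝ) / 3)}) := rfl
  rw [hK]
  apply ct_closure _ _ _ _ {x : ℝ × ℝ | 0 < x.1 ∧ x.1 < x.2 ∧ x.1 < 1 - x.1 - x.2}
  · apply ct_closed3 <;> fun_prop
  · rintro x ⟨h1, h2, h3⟩ y ⟨g1, g2, g3⟩ s t hs ht hst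
    obtain rfl : t = 1 - s := by linarith
    refine ⟨?_, ?_, ?_⟩ <;> simp <;> nlinarith
  · norm_num
  · norm_num
  · norm_num
  · rintro ⟨x, y⟩ ⟨h1, h2, h3⟩
    simp only at h1 h2 h3
    refine ct_mem_hull _ _ _ _ (y - x) (1 - x - y - x) (3 * x) (by linarith) (by linarith)
      (by linarith) (by ring) ?_
    ext <;> simp <;> ring
  · apply ct_open3 <;> fun_prop
  · rintro x ⟨h1, h2, h3⟩
    exact ⟨h1.le, h2.le, h3.le⟩
  · exact ⟨(1/10, 1/2), by norm_num⟩

lemma closure_Tref : closure Tref = {x : ℝ × ℝ | 0 ≤ x.1 ∧ 0 ≤ x.2 ∧ x.1 + x.2 ≤ 1} := by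
  have hcl : IsClosed {x : ℝ × ℝ | 0 ≤ x.1 ∧ 0 ≤ x.2 ∧ x.1 + x.2 ≤ 1} := by
    apply ct_closed3 <;> fun_prop
  apply subset_antisymm
  · refine closure_minimal ?_ hcl
    rintro x ⟨h1, h2, h3⟩
    exact ⟨h1.le, h2.le, h3.le⟩
  · rintro ⟨x, y⟩ ⟨h1, h2, h3⟩
    simp only at h1 h2 h3
    have hcont : Filter.Tendsto (fun s : ℝ => (((1 - s) * x + s * (1/3), (1 - s) * y + s * (1/3)) : ℝ × ℝ))
        (nhdsWithin 0 (Set.Ioo 0 1)) (nhds (x, y)) := by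
      have : Continuous (fun s : ℝ => (((1 - s) * x + s * (1/3), (1 - s) * y + s * (1/3)) : ℝ × ℝ)) := by
        fun_prop
      have h := this.tendsto 0
      simp only [sub_zero, one_mul, zero_mul, add_zero] at h
      exact h.mono_left nhdsWithin_le_nhds
    have hne : (nhdsWithin (0 : ℝ) (Set.Ioo 0 1)).NeBot := by
      rw [← mem_closure_iff_nhdsWithin_neBot, closure_Ioo (by norm_num)]
      simp
    refine mem_closure_of_tendsto hcont ?_
    filter_upwards [self_mem_nhdsWithin] with s hs
    obtain ⟨hs0, hs1⟩ := hs
    refine ⟨?_, ?_, ?_⟩ <;> simp only <;> nlinarith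

/-- The minimum of the barycentric coordinates. -/
def ctMu (x : ℝ × ℝ) : ℝ := min (1 - x.1 - x.2) (min x.1 x.2)

lemma ctMu_continuous : Continuous ctMu := by
  unfold ctMu; fun_prop

/-- The parametrisation of the spline space. -/
def ctPhi (k : ℕ) : (ctPD (k + 1) × ctPD k × ctPD (k - 1)) →ₗ[ℝ] (↥(closure Tref) → ℝ) where
  toFun v x :=
    MvPolynomial.eval ![(x : ℝ × ℝ).1, (x : ℝ × ℝ).2] v.1.1
    + ((x : ℝ × ℝ).2 - ctMu x) * MvPolynomial.eval ![(x : ℝ × ℝ).1, (x : ℝ × ℝ).2] v.2.1.1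
    + ((x : ℝ × ℝ).2 - ctMu x) * ((x : ℝ × ℝ).1 - ctMu x)
      * MvPolynomial.eval ![(x : ℝ × ℝ).1, (x : ℝ × ℝ).2] v.2.2.1
  map_add' u v := by
    ext x; simp; ring
  map_smul' c v := by
    ext x; simp; ring

lemma ct_piece0 {x : ℝ × ℝ} (hx : x ∈ closure (ctK 0)) : ctMu x = x.2 := by
  rw [closure_ctK0] at hx
  obtain ⟨h1, h2, h3⟩ := hx
  unfold ctMu
  rw [min_eq_right h2, min_eq_right h3]

lemma ct_piece1 {x : ℝ × ℝ} (hx : x ∈ closure (ctK 1)) : ctMu x = 1 - x.1 - x.2 := by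
  rw [closure_ctK1] at hx
  obtain ⟨h1, h2, h3⟩ := hx
  unfold ctMu
  rw [min_eq_left (le_min h2 h3)]

lemma ct_piece2 {x : ℝ × ℝ} (hx : x ∈ closure (ctK 2)) : ctMu x = x.1 := by
  rw [closure_ctK2] at hx
  obtain ⟨h1, h2, h3⟩ := hx
  unfold ctMu
  rw [min_eq_left h2, min_eq_right h3]

lemma ct_eval_continuous (p : MvPolynomial (Fin 2) ℝ) :
    Continuous (fun x : ℝ × ℝ => MvPolynomial.eval ![x.1, x.2] p) := by
  have h : Continuous (fun x : ℝ × ℝ => (![x.1, x.2] : Fin 2 → ℝ)) := by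
    refine continuous_pi ?_
    intro i
    fin_cases i <;> simp <;> fun_prop
  exact (MvPolynomial.continuous_eval p).comp h

lemma ctPD_mono {m n : ℕ} (h : m ≤ n) {p : MvPolynomial (Fin 2) ℝ} (hp : p ∈ ctPD m) :
    p ∈ ctPD n := by
  rw [mem_ctPD] at *
  intro s hs
  exact (hp s hs).trans_le h

lemma ctPhi_mem (k : ℕ) (hk : 1 ≤ k) (v) : ctPhi k v ∈ ctSplineSet k := by
  obtain ⟨m, rfl⟩ : ∃ m, k = m + 1 := ⟨k - 1, by omega⟩
  obtain ⟨⟨p, hp⟩, ⟨q, hq⟩, ⟨r, hr⟩⟩ := v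
  simp only [Nat.add_sub_cancel] at hr
  refine ⟨?_, ?_⟩
  · have hp' := (ct_eval_continuous p).comp (continuous_subtype_val (p := (· ∈ closure Tref)))
    have hq' := (ct_eval_continuous q).comp (continuous_subtype_val (p := (· ∈ closure Tref)))
    have hr' := (ct_eval_continuous r).comp (continuous_subtype_val (p := (· ∈ closure Tref)))
    have hm := ctMu_continuous.comp (continuous_subtype_val (p := (· ∈ closure Tref)))
    have h1 : Continuous (fun x : ↥(closure Tref) => (x : ℝ × ℝ).1) := by fun_prop
    have h2 : Continuous (fun x : ↥(closure Tref) => (x : ℝ × ℝ).2) := by fun_prop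
    exact (hp'.add ((h2.sub hm).mul hq')).add (((h2.sub hm).mul (h1.sub hm)).mul hr')
  · intro i
    fin_cases i
    · refine ⟨p, (mem_ctPD_succ _ _).1 hp, ?_⟩
      intro x hx
      have := ct_piece0 hx
      simp [ctPhi, this]
    · refine ⟨p + ctL 1 (-2) * (q + (2 : ℝ) • (ctL (1/2) (-1/2) * r)),
        (mem_ctPD_succ _ _).1 ?_, ?_⟩
      · exact Submodule.add_mem _ hp (ctL_mul_mem.2 (Submodule.add_mem _ hq
          (Submodule.smul_mem _ _ (ctL_mul_mem.2 hr))))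
      · intro x hx
        have := ct_piece1 hx
        simp [ctPhi, this, eval_ctL]
        ring
    · refine ⟨p - ctL 0 1 * q, (mem_ctPD_succ _ _).1 ?_, ?_⟩
      · exact Submodule.sub_mem _ hp (ctL_mul_mem.2 hq)
      · intro x hx
        have := ct_piece2 hx
        simp [ctPhi, this, eval_ctL]
        ring

lemma ctPhi_injective (k : ℕ) : Function.Injective (ctPhi k) := by
  rw [← LinearMap.ker_eq_bot, LinearMap.ker_eq_bot']
  rintro ⟨⟨p, hp⟩, ⟨q, hq⟩, ⟨r, hr⟩⟩ h
  have hT : ∀ x y : ℝ, 0 ≤ x → 0 ≤ y → x + y ≤ 1 →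
      MvPolynomial.eval ![x, y] p + (y - ctMu (x, y)) * MvPolynomial.eval ![x, y] q
      + (y - ctMu (x, y)) * (x - ctMu (x, y)) * MvPolynomial.eval ![x, y] r = 0 := by
    intro x y hx hy hxy
    have hm : (x, y) ∈ closure Tref := by rw [closure_Tref]; exact ⟨hx, hy, hxy⟩
    exact congrFun h ⟨(x, y), hm⟩
  have hp0 : p = 0 := by
    refine ct_zero_of_box (9/20) (11/20) 0 (1/10) (by norm_num) (by norm_num) ?_
    intro x y h1 h2 h3 h4
    have hK : (x, y) ∈ closure (ctK 0) := by
      rw [closure_ctK0]; refine ⟨?_, ?_, ?_⟩ <;> simp only <;> linarith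
    have := hT x y (by linarith) (by linarith) (by linarith)
    rw [ct_piece0 hK] at this
    simpa using this
  subst hp0
  have hq0 : q = 0 := by
    have : ctL 0 1 * q = 0 := by
      refine ct_zero_of_box 0 (1/10) (9/20) (11/20) (by norm_num) (by norm_num) ?_
      intro x y h1 h2 h3 h4
      have hK : (x, y) ∈ closure (ctK 2) := by
        rw [closure_ctK2]; refine ⟨?_, ?_, ?_⟩ <;> simp only <;> linarith
      have := hT x y (by linarith) (by linarith) (by linarith)
      rw [ct_piece2 hK] at this
      rw [map_mul, eval_ctL]
      simp only [map_zero] at this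
      linarith
    exact (mul_eq_zero.1 this).resolve_left (ctL_ne_zero _ _)
  subst hq0
  have hr0 : r = 0 := by
    have : ctL 1 (-2) * (ctL (1/2) (-1/2) * r) = 0 := by
      refine ct_zero_of_box (2/5) (1/2) (2/5) (1/2) (by norm_num) (by norm_num) ?_
      intro x y h1 h2 h3 h4
      have hK : (x, y) ∈ closure (ctK 1) := by
        rw [closure_ctK1]; refine ⟨?_, ?_, ?_⟩ <;> simp only <;> linarith
      have := hT x y (by linarith) (by linarith) (by linarith)
      rw [ct_piece1 hK] at this
      rw [map_mul, map_mul, eval_ctL, eval_ctL]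
      simp only [map_zero] at this
      linarith
    exact (mul_eq_zero.1 ((mul_eq_zero.1 this).resolve_left (ctL_ne_zero _ _))).resolve_left
      (ctL_ne_zero _ _)
  subst hr0
  rfl

lemma ct_cover {x : ℝ × ℝ} (hx : x ∈ closure Tref) :
    x ∈ closure (ctK 0) ∨ x ∈ closure (ctK 1) ∨ x ∈ closure (ctK 2) := by
  rw [closure_Tref] at hx
  rw [closure_ctK0, closure_ctK1, closure_ctK2]
  obtain ⟨h1, h2, h3⟩ := hx
  simp only [Set.mem_ofPred_eq]
  rcases le_total x.1 x.2 with h | h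
  · rcases le_total x.1 (1 - x.1 - x.2) with g | g
    · right; right; exact ⟨h1, h, g⟩
    · right; left; exact ⟨by linarith, g, by linarith⟩
  · rcases le_total x.2 (1 - x.1 - x.2) with g | g
    · left; exact ⟨h2, h, g⟩
    · right; left; exact ⟨by linarith, by linarith, g⟩

lemma ctPhi_surj (k : ℕ) (hk : 1 ≤ k) (w) (hw : w ∈ ctSplineSet k) : ∃ v, ctPhi k v = w := by
  obtain ⟨m, rfl⟩ : ∃ m, k = m + 1 := ⟨k - 1, by omega⟩
  obtain ⟨-, hw⟩ := hw
  obtain ⟨p0, hd0, hp0⟩ := hw 0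
  obtain ⟨p1, hd1, hp1⟩ := hw 1
  obtain ⟨p2, hd2, hp2⟩ := hw 2
  rw [← mem_ctPD_succ] at hd0 hd1 hd2
  have e0 : ∀ t ∈ Set.Ioo (0 : ℝ) (1/3),
      MvPolynomial.eval ![0 + 1 * t, t] (p2 - p0) = 0 := by
    rintro t ⟨ht0, ht1⟩
    have hm : (0 + 1 * t, t) ∈ closure Tref := by
      rw [closure_Tref]; refine ⟨?_, ?_, ?_⟩ <;> simp only <;> linarith
    have a := hp0 ⟨_, hm⟩ (by
      rw [closure_ctK0]; refine ⟨?_, ?_, ?_⟩ <;> simp only <;> linarith)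
    have b := hp2 ⟨_, hm⟩ (by
      rw [closure_ctK2]; refine ⟨?_, ?_, ?_⟩ <;> simp only <;> linarith)
    simp only at a b
    rw [map_sub, ← a, ← b, sub_self]
  obtain ⟨q, hq⟩ := ctL_dvd (Set.Ioo_infinite (by norm_num)) e0
  have hqd : q ∈ ctPD (m + 1) := by
    rw [← ctL_mul_mem (α := 0) (β := 1), ← hq]
    exact Submodule.sub_mem _ hd2 hd0
  have e1 : ∀ t ∈ Set.Ioo (0 : ℝ) (1/3),
      MvPolynomial.eval ![1 + (-2) * t, t] (p1 - p0 + ctL 1 (-2) * q) = 0 := by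
    rintro t ⟨ht0, ht1⟩
    have hm : (1 + (-2) * t, t) ∈ closure Tref := by
      rw [closure_Tref]; refine ⟨?_, ?_, ?_⟩ <;> simp only <;> linarith
    have a := hp0 ⟨_, hm⟩ (by
      rw [closure_ctK0]; refine ⟨?_, ?_, ?_⟩ <;> simp only <;> linarith)
    have b := hp1 ⟨_, hm⟩ (by
      rw [closure_ctK1]; refine ⟨?_, ?_, ?_⟩ <;> simp only <;> linarith)
    simp only at a b
    rw [map_add, map_mul, eval_ctL, map_sub, ← a, ← b]
    ring
  obtain ⟨s, hs⟩ := ctL_dvd (Set.Ioo_infinite (by norm_num)) e1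
  have hsd : s ∈ ctPD (m + 1) := by
    rw [← ctL_mul_mem (α := 1) (β := -2), ← hs]
    exact Submodule.add_mem _ (Submodule.sub_mem _ hd1 hd0) (ctL_mul_mem.2 hqd)
  have e2 : ∀ t ∈ Set.Ioo (1/3 : ℝ) 1,
      MvPolynomial.eval ![1/2 + (-1/2) * t, t] s = 0 := by
    rintro t ⟨ht0, ht1⟩
    have hm : (1/2 + (-1/2) * t, t) ∈ closure Tref := by
      rw [closure_Tref]; refine ⟨?_, ?_, ?_⟩ <;> simp only <;> linarith
    have a := hp2 ⟨_, hm⟩ (by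
      rw [closure_ctK2]; refine ⟨?_, ?_, ?_⟩ <;> simp only <;> linarith)
    have b := hp1 ⟨_, hm⟩ (by
      rw [closure_ctK1]; refine ⟨?_, ?_, ?_⟩ <;> simp only <;> linarith)
    simp only at a b
    have c := congrArg (MvPolynomial.eval ![1/2 + (-1/2) * t, t]) hs
    have d := congrArg (MvPolynomial.eval ![1/2 + (-1/2) * t, t]) hq
    rw [map_add, map_mul, map_mul, eval_ctL, map_sub, ← b] at c
    rw [map_mul, eval_ctL, map_sub, ← a] at d
    have hz : (t * (3/2) - 1/2) * MvPolynomial.eval ![1/2 + (-1/2) * t, t] s = 0 := by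
      linear_combination d - c
    exact (mul_eq_zero.1 hz).resolve_left (by intro h; linarith)
  obtain ⟨r, hr⟩ := ctL_dvd (Set.Ioo_infinite (by norm_num)) e2
  have hrd : r ∈ ctPD m := by
    rw [← ctL_mul_mem (α := 1/2) (β := -1/2), ← hr]
    exact hsd
  refine ⟨(⟨p0, hd0⟩, ⟨-q, Submodule.neg_mem _ hqd⟩,
    ⟨(1/2 : ℝ) • r, Submodule.smul_mem _ _ hrd⟩), ?_⟩
  ext ⟨⟨x, y⟩, hx⟩
  have c := congrArg (MvPolynomial.eval ![x, y]) hs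
  have d := congrArg (MvPolynomial.eval ![x, y]) hq
  have e := congrArg (MvPolynomial.eval ![x, y]) hr
  rw [map_add, map_mul, map_mul, eval_ctL, map_sub] at c
  rw [map_mul, eval_ctL, map_sub] at d
  rw [map_mul, eval_ctL] at e
  rcases ct_cover hx with h | h | h
  · rw [hp0 _ h]
    simp [ctPhi, ct_piece0 h]
  · rw [hp1 _ h]
    simp [ctPhi, ct_piece1 h]
    rw [e] at c
    linear_combination -c
  · rw [hp2 _ h]
    simp [ctPhi, ct_piece2 h]
    linear_combination -d

theorem stmt10 (k : ℕ) (hk : 1 ≤ k) :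
    ∃ u : Fin (3 * k * (k + 1) / 2 + 1) → (↥(closure Tref) → ℝ),
      (∀ j, u j ∈ ctSplineSet k) ∧ LinearIndependent ℝ u ∧
      ∀ w ∈ ctSplineSet k, ∃ c : Fin (3 * k * (k + 1) / 2 + 1) → ℝ,
        w = ∑ j, c j • u j := by
  let B := Module.finBasisOfFinrankEq ℝ (ctPD (k + 1) × ctPD k × ctPD (k - 1)) (finrank_ct k hk)
  refine ⟨fun j => ctPhi k (B j), fun j => ctPhi_mem k hk _, ?_, ?_⟩
  · exact B.linearIndependent.map' (ctPhi k) (LinearMap.ker_eq_bot.2 (ctPhi_injective k))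
  · intro w hw
    obtain ⟨v, rfl⟩ := ctPhi_surj k hk w hw
    refine ⟨fun j => B.repr v j, ?_⟩
    conv_lhs => rw [← B.sum_repr v]
    simp only [map_sum, map_smul]
end
end
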